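/- There exists a constant C₁ > 0 such that for every u ∈ C₀^∞(B⁴) satisfying ∫_{B⁴} |Δu(x)|² dx − 9 ∫_{B⁴} u(x)²/(1 − |x|²)⁴ dx ≤ 1, one has 16 ∫_{B⁴} (e^{32π²u(x)²} − 1 − 32π²u(x)²)/(1 − |x|²)⁴ dx ≤ C₁. -/

import Mathlib

open MeasureTheory Real

noncomputable section

/-- The Euclidean space `ℝ⁴`. -/
abbrev E4 := EuclideanSpace ℝ (Fin 4)

/-- The Euclidean Laplacian on `ℝ⁴`. -/
def lapE (u : E4 → ℝ) (x : E4) : ℝ :=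
  ∑ i, fderiv ℝ (fun y => fderiv ℝ u y (EuclideanSpace.single i 1)) x (EuclideanSpace.single i 1)

end

/-- Partial derivative in the `i`-th coordinate direction. -/
noncomputable def pderivE (i : Fin 4) (g : E4 → ℝ) (x : E4) : ℝ :=
  fderiv ℝ g x (EuclideanSpace.single i 1)

theorem lapE_eq_sum (u : E4 → ℝ) (x : E4) : lapE u x = ∑ i, pderivE i (pderivE i u) x := rfl

theorem contDiff_pderivE {g : E4 → ℝ} (hg : ContDiff ℝ (⊤ : ℕ∞) g) (i : Fin 4) :
    ContDiff ℝ (⊤ : ℕ∞) (pderivE i g) := by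
  unfold pderivE
  exact (hg.fderiv_right (m := (⊤ : ℕ∞)) (by simp)).clm_apply contDiff_const

theorem hasCompactSupport_pderivE {g : E4 → ℝ} (hg : HasCompactSupport g) (i : Fin 4) :
    HasCompactSupport (pderivE i g) := by
  exact hg.fderiv_apply (𝕜 := ℝ) _

theorem contDiff_lapE {v : E4 → ℝ} (hv : ContDiff ℝ (⊤ : ℕ∞) v) : ContDiff ℝ (⊤ : ℕ∞) (lapE v) :=
  ContDiff.sum fun i _ => contDiff_pderivE (contDiff_pderivE hv i) i

theorem lapE_eq_zero_of_notMem_tsupport {v : E4 → ℝ} {x : E4} (hx : x ∉ tsupport v) :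
    lapE v x = 0 := by
  have hz : ∀ i, pderivE i (pderivE i v) x = 0 := fun i => by
    have h1 : tsupport (pderivE i (pderivE i v)) ⊆ tsupport v :=
      (tsupport_fderiv_apply_subset ℝ _).trans (tsupport_fderiv_apply_subset ℝ _)
    exact image_eq_zero_of_notMem_tsupport fun h => hx (h1 h)
  simp [lapE_eq_sum, hz]

theorem hasCompactSupport_lapE {v : E4 → ℝ} (hv : HasCompactSupport v) :
    HasCompactSupport (lapE v) :=
  HasCompactSupport.intro (K := tsupport v) hv fun _ hx => lapE_eq_zero_of_notMem_tsupport hx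

theorem ContDiff.hasDerivAt_line {g : E4 → ℝ} {n : WithTop ℕ∞} (hg : ContDiff ℝ n g) (hn : n ≠ 0)
    (i : Fin 4) (x : E4) :
    HasDerivAt (fun s : ℝ => g (x + s • EuclideanSpace.single i (1 : ℝ))) (pderivE i g x) 0 :=
  ((hg.differentiable hn x).hasFDerivAt.hasLineDerivAt _)

theorem pderivE_comm {g : E4 → ℝ} (hg : ContDiff ℝ (⊤ : ℕ∞) g) (i j : Fin 4) (x : E4) :
    pderivE i (pderivE j g) x = pderivE j (pderivE i g) x := by
  have h2 : Differentiable ℝ (fderiv ℝ g) :=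
    (hg.fderiv_right (m := (⊤ : ℕ∞)) (by simp)).differentiable (by simp)
  have key : ∀ k l, pderivE k (pderivE l g) x
      = fderiv ℝ (fderiv ℝ g) x (EuclideanSpace.single k 1) (EuclideanSpace.single l 1) := by
    intro k l
    unfold pderivE
    rw [fderiv_clm_apply (h2 x) (by fun_prop)]
    simp
  rw [key, key]
  have := (hg.contDiffAt (x := x)).isSymmSndFDerivAt (by
    simpa using (WithTop.coe_le_coe.2 (le_top : (2 : ℕ∞) ≤ ⊤)))
  exact this _ _

/-- The integral of a derivative of a compactly supported function vanishes. -/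
theorem integral_hasLineDeriv_eq_zero {Y Y' : E4 → ℝ} (e : E4)
    (hY : Continuous Y) (hYc : HasCompactSupport Y)
    (hY'c : Integrable Y')
    (h : ∀ x, HasDerivAt (fun s : ℝ => Y (x + s • e)) (Y' x) 0) :
    ∫ x, Y' x = 0 := by
  have := integral_bilinear_hasLineDerivAt_right_eq_neg_left_of_integrable (μ := volume)
    (f := Y) (f' := Y') (g := fun _ => (1:ℝ)) (g' := fun _ => (0:ℝ)) (v := e)
    (B := ContinuousLinearMap.mul ℝ ℝ) (by simpa using hY'c) (by simp)
    (by simpa using hY.integrable_of_hasCompactSupport hYc)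
    (fun x _ => h x) (fun x _ => by simp [HasLineDerivAt, hasDerivAt_const])
  simpa using this.symm

theorem hasDerivAt_coord_line (i j : Fin 4) (x : E4) :
    HasDerivAt (fun s : ℝ => (x + s • EuclideanSpace.single i (1 : ℝ) : E4) j)
      (if j = i then 1 else 0) 0 := by
  have : (fun s : ℝ => (x + s • EuclideanSpace.single i (1 : ℝ) : E4) j)
      = fun s => x j + s * (if j = i then 1 else 0) := by
    ext s; simp
  rw [this]
  simpa using ((hasDerivAt_id (0:ℝ)).mul_const (if j = i then (1:ℝ) else 0)).const_add (x j)

theorem norm_sq_E4 (x : E4) : ‖x‖ ^ 2 = x 0 ^ 2 + x 1 ^ 2 + x 2 ^ 2 + x 3 ^ 2 := by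
  rw [EuclideanSpace.norm_sq_eq]; simp [Fin.sum_univ_four]

/-- The Laplacian of `u = t v` in terms of `v`, where `t = 1 - |x|²`. -/
theorem lap_mul_weight {v u : E4 → ℝ} (hv : ContDiff ℝ (⊤ : ℕ∞) v)
    (huv : ∀ x, u x = (1 - ‖x‖ ^ 2) * v x) (x : E4) :
    lapE u x = (1 - ‖x‖ ^ 2) * lapE v x - 4 * (∑ j, x j * pderivE j v x) - 8 * v x := by
  have hp : ∀ i, ∀ x, HasDerivAt (fun s : ℝ => v (x + s • EuclideanSpace.single i (1 : ℝ)))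
      (pderivE i v x) 0 := fun i x => hv.hasDerivAt_line (by simp) i x
  have hq : ∀ i j, ∀ x, HasDerivAt
      (fun s : ℝ => pderivE j v (x + s • EuclideanSpace.single i (1 : ℝ)))
      (pderivE i (pderivE j v) x) 0 :=
    fun i j x => (contDiff_pderivE hv j).hasDerivAt_line (by simp) i x
  have hc : ∀ i j, ∀ x : E4, _ := fun i j x => hasDerivAt_coord_line i j x
  have huC : ContDiff ℝ (⊤ : ℕ∞) u := by
    rw [funext huv]; exact ((contDiff_const.sub (contDiff_norm_sq ℝ)).mul hv)
  have hpu : ∀ i x, pderivE i u x = -2 * x i * v x + (1 - ‖x‖ ^ 2) * pderivE i v x := by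
    intro i x
    have h1 := huC.hasDerivAt_line (by simp) i x
    refine h1.unique ?_
    simp only [huv, norm_sq_E4]
    have := (((((((hc i 0 x).pow 2).add ((hc i 1 x).pow 2)).add ((hc i 2 x).pow 2)).add
      ((hc i 3 x).pow 2)).const_sub 1).mul (hp i x))
    refine this.congr_deriv ?_
    fin_cases i <;> simp
  have hppu : ∀ i, pderivE i (pderivE i u) x = -2 * v x - 4 * x i * pderivE i v x
      + (1 - ‖x‖ ^ 2) * pderivE i (pderivE i v) x := by
    intro i
    have h1 := (contDiff_pderivE huC i).hasDerivAt_line (by simp) i x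
    refine h1.unique ?_
    simp only [hpu, norm_sq_E4]
    have := (((hc i i x).const_mul (-2)).mul (hp i x)).add
      (((((((hc i 0 x).pow 2).add ((hc i 1 x).pow 2)).add ((hc i 2 x).pow 2)).add
      ((hc i 3 x).pow 2)).const_sub 1).mul (hq i i x))
    refine this.congr_deriv ?_
    fin_cases i <;> simp <;> ring
  simp only [lapE_eq_sum, hppu, Fin.sum_univ_four]
  ring

/-- Squared length of the gradient. -/
noncomputable def gradSq (v : E4 → ℝ) (x : E4) : ℝ := ∑ i, pderivE i v x ^ 2

theorem integrable_of_cont {g : E4 → ℝ} (hg : Continuous g) (hc : HasCompactSupport g) :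
    Integrable g := hg.integrable_of_hasCompactSupport hc

theorem hasCompactSupport_sq {g : E4 → ℝ} (hc : HasCompactSupport g) :
    HasCompactSupport fun x => g x ^ 2 :=
  hc.comp_left (g := fun s : ℝ => s ^ 2) (by simp)

theorem continuous_coord (i : Fin 4) : Continuous fun x : E4 => x i := by fun_prop

set_option maxHeartbeats 1000000 in
theorem energy_identity {v u y : E4 → ℝ} (hv : ContDiff ℝ (⊤ : ℕ∞) v) (hvc : HasCompactSupport v)
    (hy : Continuous y) (hyc : HasCompactSupport y)
    (huv : ∀ x, u x = (1 - ‖x‖ ^ 2) * v x) (hvy : ∀ x, v x = (1 - ‖x‖ ^ 2) * y x) :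
    (∫ x, lapE u x ^ 2) - 9 * ∫ x, y x ^ 2 =
      (∫ x, ((1 - ‖x‖ ^ 2) * lapE v x + y x) ^ 2) + 10 * ∫ x, (gradSq v x - y x ^ 2) := by
  have hp : ∀ i, ∀ x, HasDerivAt (fun s : ℝ => v (x + s • EuclideanSpace.single i (1 : ℝ)))
      (pderivE i v x) 0 := fun i x => hv.hasDerivAt_line (by simp) i x
  have hq : ∀ i j, ∀ x, HasDerivAt
      (fun s : ℝ => pderivE j v (x + s • EuclideanSpace.single i (1 : ℝ)))
      (pderivE i (pderivE j v) x) 0 :=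
    fun i j x => (contDiff_pderivE hv j).hasDerivAt_line (by simp) i x
  have hc : ∀ i j, ∀ x : E4, _ := fun i j x => hasDerivAt_coord_line i j x
  have hvC := hv.continuous
  have hpC : ∀ i, Continuous (pderivE i v) := fun i => (contDiff_pderivE hv i).continuous
  have hpc : ∀ i, HasCompactSupport (pderivE i v) := fun i => hasCompactSupport_pderivE hvc i
  have hqC : ∀ i j, Continuous (pderivE i (pderivE j v)) :=
    fun i j => (contDiff_pderivE (contDiff_pderivE hv j) i).continuous
  have hxC := continuous_coord
  have hlC : Continuous (lapE v) := (contDiff_lapE hv).continuous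
  have hlc : HasCompactSupport (lapE v) := hasCompactSupport_lapE hvc
  set Y : Fin 4 → E4 → ℝ := fun i x =>
    -8 * ((1 - (x 0 ^ 2 + x 1 ^ 2 + x 2 ^ 2 + x 3 ^ 2)) *
      (x 0 * pderivE 0 v x + x 1 * pderivE 1 v x + x 2 * pderivE 2 v x + x 3 * pderivE 3 v x)
       * pderivE i v x)
    + 4 * ((1 - (x 0 ^ 2 + x 1 ^ 2 + x 2 ^ 2 + x 3 ^ 2)) * x i *
      (pderivE 0 v x ^ 2 + pderivE 1 v x ^ 2 + pderivE 2 v x ^ 2 + pderivE 3 v x ^ 2))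
    - (18 - 16 * (x 0 ^ 2 + x 1 ^ 2 + x 2 ^ 2 + x 3 ^ 2)) * (v x * pderivE i v x)
    + 16 * (x i * v x ^ 2) with hY
  have hYd : ∀ i x, ∃ d, HasDerivAt (fun s : ℝ => Y i (x + s • EuclideanSpace.single i (1 : ℝ))) d 0
      ∧ d = -8 * ((-2 * x i) * (∑ j, x j * pderivE j v x) * pderivE i v x
        + (1 - ‖x‖ ^ 2) * (pderivE i v x + ∑ j, x j * pderivE i (pderivE j v) x) * pderivE i v x
        + (1 - ‖x‖ ^ 2) * (∑ j, x j * pderivE j v x) * pderivE i (pderivE i v) x)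
        + 4 * ((-2 * x i) * x i * gradSq v x + (1 - ‖x‖ ^ 2) * gradSq v x
          + (1 - ‖x‖ ^ 2) * x i * (2 * ∑ j, pderivE j v x * pderivE i (pderivE j v) x))
        + 32 * x i * v x * pderivE i v x
        - (18 - 16 * ‖x‖ ^ 2) * (pderivE i v x ^ 2 + v x * pderivE i (pderivE i v) x)
        + 16 * (v x ^ 2 + 2 * x i * v x * pderivE i v x) := by
    intro i x
    have hr := ((((hc i 0 x).pow 2).add ((hc i 1 x).pow 2)).add ((hc i 2 x).pow 2)).add
      ((hc i 3 x).pow 2)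
    have hX := ((((hc i 0 x).mul (hq i 0 x)).add ((hc i 1 x).mul (hq i 1 x))).add
      ((hc i 2 x).mul (hq i 2 x))).add ((hc i 3 x).mul (hq i 3 x))
    have hP := ((((hq i 0 x).pow 2).add ((hq i 1 x).pow 2)).add ((hq i 2 x).pow 2)).add
      ((hq i 3 x).pow 2)
    refine ⟨_, ((((((hr.const_sub 1).mul hX).mul (hq i i x)).const_mul (-8)).add
      ((((hr.const_sub 1).mul (hc i i x)).mul hP).const_mul 4)).sub
      (((hr.const_mul 16).const_sub 18).mul ((hp i x).mul (hq i i x)))).add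
      (((hc i i x).mul ((hp i x).pow 2)).const_mul 16), ?_⟩
    simp only [norm_sq_E4, gradSq, Fin.sum_univ_four]
    fin_cases i <;> simp <;> ring
  choose d hd hd' using hYd
  have hYC : ∀ i, Continuous (Y i) := fun i => by simp only [hY]; fun_prop
  have hYc : ∀ i, HasCompactSupport (Y i) := fun i => by
    refine HasCompactSupport.intro (K := tsupport v) hvc fun x hx => ?_
    have h0 : v x = 0 := image_eq_zero_of_notMem_tsupport hx
    have h1 : ∀ i, pderivE i v x = 0 := fun i => image_eq_zero_of_notMem_tsupport
      fun h => hx (tsupport_fderiv_apply_subset ℝ _ h)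
    simp [hY, h0, h1]
  have hdI : ∀ i, Integrable (d i) := fun i => by
    rw [show d i = _ from funext (hd' i)]
    refine integrable_of_cont (by simp only [gradSq]; fun_prop) ?_
    refine HasCompactSupport.intro (K := tsupport v) hvc fun x hx => ?_
    have h0 : v x = 0 := image_eq_zero_of_notMem_tsupport hx
    have h1 : ∀ i, pderivE i v x = 0 := fun i => image_eq_zero_of_notMem_tsupport
      fun h => hx (tsupport_fderiv_apply_subset ℝ _ h)
    have h2 : pderivE i (pderivE i v) x = 0 := image_eq_zero_of_notMem_tsupport
      fun h => hx (tsupport_fderiv_apply_subset ℝ _ (tsupport_fderiv_apply_subset ℝ _ h))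
    simp [h0, h1, h2, gradSq]
  have hd0 : ∀ i, ∫ x, d i x = 0 := fun i =>
    integral_hasLineDeriv_eq_zero _ (hYC i) (hYc i) (hdI i) (hd i)
  have huC : ∀ x, lapE u x = _ := lap_mul_weight hv huv
  have hptw : ∀ x, lapE u x ^ 2 - 9 * y x ^ 2 = ((1 - ‖x‖ ^ 2) * lapE v x + y x) ^ 2
      + 10 * (gradSq v x - y x ^ 2) + ∑ i, d i x := by
    intro x
    have hs := fun i j => pderivE_comm hv i j x
    rw [huC]
    simp only [hd', Fin.sum_univ_four, gradSq, lapE_eq_sum, norm_sq_E4, hvy]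
    rw [hs 1 0, hs 2 0, hs 3 0, hs 2 1, hs 3 1, hs 3 2]
    ring
  have i1 : Integrable fun x => lapE u x ^ 2 := by
    simp only [huC]
    refine integrable_of_cont (by fun_prop) ?_
    refine HasCompactSupport.intro (K := tsupport v ∪ tsupport (lapE v))
      (hvc.isCompact.union hlc.isCompact) fun x hx => ?_
    have h0 : v x = 0 := image_eq_zero_of_notMem_tsupport fun h => hx (Or.inl h)
    have h1 : ∀ i, pderivE i v x = 0 := fun i => image_eq_zero_of_notMem_tsupport
      fun h => hx (Or.inl (tsupport_fderiv_apply_subset ℝ _ h))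
    have h2 : lapE v x = 0 := image_eq_zero_of_notMem_tsupport fun h => hx (Or.inr h)
    simp [h0, h1, h2]
  have i2 : Integrable fun x => y x ^ 2 :=
    integrable_of_cont (by fun_prop) (hasCompactSupport_sq hyc)
  have i3 : Integrable fun x => gradSq v x := by
    simp only [gradSq]
    refine integrable_finsetSum _ fun i _ => integrable_of_cont ((hpC i).pow 2)
      (hasCompactSupport_sq (hpc i))
  have i4 : Integrable fun x => ((1 - ‖x‖ ^ 2) * lapE v x + y x) ^ 2 := by
    refine integrable_of_cont (by fun_prop) ?_
    have : HasCompactSupport fun x => (1 - ‖x‖ ^ 2) * lapE v x + y x := hlc.mul_left.add hyc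
    exact hasCompactSupport_sq this
  calc (∫ x, lapE u x ^ 2) - 9 * ∫ x, y x ^ 2
      = ∫ x, (lapE u x ^ 2 - 9 * y x ^ 2) := by
        rw [integral_sub i1 (i2.const_mul 9), integral_const_mul]
    _ = ∫ x, (((1 - ‖x‖ ^ 2) * lapE v x + y x) ^ 2
      + 10 * (gradSq v x - y x ^ 2) + ∑ i, d i x) := by simp only [hptw]
    _ = _ := by
        have i5 : Integrable fun x => 10 * (gradSq v x - y x ^ 2) := (i3.sub i2).const_mul 10
        have i6 : Integrable fun x => ((1 - ‖x‖ ^ 2) * lapE v x + y x) ^ 2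
          + 10 * (gradSq v x - y x ^ 2) := i4.add i5
        rw [integral_add i6 (integrable_finsetSum _ fun i _ => hdI i),
          integral_add i4 i5, integral_const_mul, integral_finsetSum _ fun i _ => hdI i]
        simp [hd0]

theorem hasDerivAt_abs_cube {g : ℝ → ℝ} {g' s : ℝ} (hg : HasDerivAt g g' s) :
    HasDerivAt (fun s => |g s| ^ 3) (3 * |g s| * g s * g') s := by
  have h := (hasDerivAt_abs_rpow (g s) (p := 3) (by norm_num)).comp s hg
  have e : (fun s => |g s| ^ 3) = (fun x : ℝ => |x| ^ (3:ℝ)) ∘ g := by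
    ext s; exact (Real.rpow_natCast _ 3).symm
  rw [e]
  refine h.congr_deriv ?_
  norm_num

theorem norm_fderiv_le_sqrt_gradSq (v : E4 → ℝ) (x : E4) : ‖fderiv ℝ v x‖ ≤ √(gradSq v x) := by
  refine ContinuousLinearMap.opNorm_le_bound _ (Real.sqrt_nonneg _) fun z => ?_
  have hz : fderiv ℝ v x z = ∑ i, z i * pderivE i v x := by
    conv_lhs => rw [← (EuclideanSpace.basisFun (Fin 4) ℝ).sum_repr z]
    simp [pderivE]
  rw [hz, Real.norm_eq_abs]
  refine abs_le_of_sq_le_sq ?_ (by positivity)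
  rw [gradSq, mul_pow, Real.sq_sqrt (Finset.sum_nonneg fun i _ => sq_nonneg _),
      EuclideanSpace.real_norm_sq_eq]
  rw [mul_comm]
  exact Finset.sum_mul_sq_le_sq_mul_sq _ _ _

theorem integral_cube_sobolev : ∃ K : ℝ, 0 ≤ K ∧ ∀ v : E4 → ℝ, ContDiff ℝ (⊤ : ℕ∞) v →
    HasCompactSupport v →
      (∫ x, v x ^ 4) ^ 3 ≤ K * (∫ x, v x ^ 2 * √(gradSq v x)) ^ 4 := by
  have hp : Real.HolderConjugate (Module.finrank ℝ E4) (4 / 3 : ℝ) := by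
    rw [finrank_euclideanSpace_fin]
    exact Real.holderConjugate_iff.2 ⟨by norm_num, by norm_num⟩
  refine ⟨(lintegralPowLePowLIntegralFDerivConst (volume : Measure E4) (4 / 3)) ^ 3 * 81, by
      positivity,
    fun v hv hvc => ?_⟩
  set C := lintegralPowLePowLIntegralFDerivConst (volume : Measure E4) (4 / 3)
  have hg : ContDiff ℝ 1 (fun x => v x ^ 3) := (hv.pow 3).of_le (by exact_mod_cast le_top)
  have hgc : HasCompactSupport (fun x => v x ^ 3) :=
      hvc.comp_left (g := fun s : ℝ => s ^ 3) (by simp)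
  have h := lintegral_pow_le_pow_lintegral_fderiv volume hg hgc hp
  have hpC : ∀ i, Continuous (pderivE i v) := fun i => (contDiff_pderivE hv i).continuous
  have hvC := hv.continuous
  have hGi : Integrable (fun x => v x ^ 2 * √(gradSq v x)) := by
    refine integrable_of_cont ?_ (hasCompactSupport_sq hvc).mul_right
    simp only [gradSq]; fun_prop
  have hXi : Integrable (fun x => v x ^ 4) :=
    integrable_of_cont (by fun_prop) (hvc.comp_left (g := fun s : ℝ => s ^ 4) (by simp))
  have hX : ∫⁻ x, ‖v x ^ 3‖ₑ ^ (4 / 3 : ℝ) = ENNReal.ofReal (∫ x, v x ^ 4) := by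
    rw [ofReal_integral_eq_lintegral_ofReal hXi (ae_of_all _ fun x =>
        (by positivity : (0 : ℝ) ≤ v x ^ 4))]
    refine lintegral_congr fun x => ?_
    rw [Real.enorm_eq_ofReal_abs, ENNReal.ofReal_rpow_of_nonneg (by positivity) (by norm_num)]
    congr 1
    rw [abs_pow, ← Real.rpow_natCast, ← Real.rpow_mul (abs_nonneg _)]
    norm_num
    exact Even.pow_abs (by decide) _
  have hG : ∫⁻ x, ‖fderiv ℝ (fun x => v x ^ 3) x‖ₑ ≤
      ENNReal.ofReal (3 * ∫ x, v x ^ 2 * √(gradSq v x)) := by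
    rw [← integral_const_mul, ofReal_integral_eq_lintegral_ofReal (hGi.const_mul 3)
      (ae_of_all _ fun x => by positivity)]
    refine lintegral_mono fun x => ?_
    rw [← ofReal_norm]
    apply ENNReal.ofReal_le_ofReal
    rw [fderiv_fun_pow 3 (hv.differentiable (by simp) x)]
    rw [norm_smul]
    simp
    rw [mul_assoc]
    gcongr
    exact norm_fderiv_le_sqrt_gradSq v x
  have hG0 : 0 ≤ ∫ x, v x ^ 2 * √(gradSq v x) := integral_nonneg fun x => by positivity
  have h3 : ENNReal.ofReal (∫ x, v x ^ 4) ≤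
      C * ENNReal.ofReal (3 * ∫ x, v x ^ 2 * √(gradSq v x)) ^ (4 / 3 : ℝ) := by
    rw [← hX]; exact h.trans (by gcongr)
  rw [ENNReal.ofReal_rpow_of_nonneg (by positivity) (by norm_num), ← ENNReal.ofReal_coe_nnreal,
    ← ENNReal.ofReal_mul (by positivity), ENNReal.ofReal_le_ofReal_iff (by positivity)] at h3
  have h4 := pow_le_pow_left₀ (integral_nonneg fun x => by positivity) h3 3
  refine h4.trans (le_of_eq ?_)
  rw [mul_pow, ← Real.rpow_mul_natCast (by positivity)]
  norm_num
  ring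

theorem sq_le_of_forall_le {G X D : ℝ} (hG : 0 ≤ G) (hX : 0 ≤ X) (hD : 0 ≤ D)
    (h : ∀ s > 0, G ≤ s * X + D / s) : G ^ 2 ≤ 4 * X * D := by
  have := discrim_le_zero (a := X) (b := -G) (c := D) fun s => by
    rcases le_or_gt s 0 with hs | hs
    · have h1 := mul_nonneg hX (mul_self_nonneg s)
      nlinarith [mul_nonneg hG (neg_nonneg.2 hs)]
    · have h1 := mul_le_mul_of_nonneg_left (h s hs) hs.le
      rw [mul_add, mul_div_cancel₀ _ hs.ne'] at h1
      linarith
  unfold discrim at this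
  linarith

/-- A Hardy–Sobolev–Maz'ya inequality on the unit ball of `ℝ⁴`. -/
theorem hardy_sobolev_mazya : ∃ K : ℝ, 0 < K ∧ ∀ v y : E4 → ℝ, ContDiff ℝ (⊤ : ℕ∞) v →
    ContDiff ℝ (⊤ : ℕ∞) y → HasCompactSupport v → HasCompactSupport y →
    (∀ x, v x = (1 - ‖x‖ ^ 2) * y x) → (∀ x, 1 ≤ ‖x‖ → y x = 0) →
    0 ≤ ∫ x, (gradSq v x - y x ^ 2) ∧
    ∫ x, v x ^ 4 ≤ (K * ∫ x, (gradSq v x - y x ^ 2)) ^ 2 := by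
  obtain ⟨K, hK, hS⟩ := integral_cube_sobolev
  refine ⟨√K * 2500 + 1, by positivity, fun v y hv hy hvc hyc hvy hy0 => ?_⟩
  have hp : ∀ i, ∀ x, HasDerivAt (fun s : ℝ => v (x + s • EuclideanSpace.single i (1 : ℝ)))
      (pderivE i v x) 0 := fun i x => hv.hasDerivAt_line (by simp) i x
  have hyp : ∀ i, ∀ x, HasDerivAt (fun s : ℝ => y (x + s • EuclideanSpace.single i (1 : ℝ)))
      (pderivE i y x) 0 := fun i x => hy.hasDerivAt_line (by simp) i x
  have hc : ∀ i j, ∀ x : E4, _ := fun i j x => hasDerivAt_coord_line i j x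
  have hvC := hv.continuous
  have hyC := hy.continuous
  have hpC : ∀ i, Continuous (pderivE i v) := fun i => (contDiff_pderivE hv i).continuous
  have hypC : ∀ i, Continuous (pderivE i y) := fun i => (contDiff_pderivE hy i).continuous
  have hpc : ∀ i, HasCompactSupport (pderivE i v) := fun i => hasCompactSupport_pderivE hvc i
  have hxC := continuous_coord
  have hpy : ∀ i x, pderivE i v x = -2 * x i * y x + (1 - ‖x‖ ^ 2) * pderivE i y x := by
    intro i x
    refine (hp i x).unique ?_
    simp only [hvy, norm_sq_E4]
    have := (((((((hc i 0 x).pow 2).add ((hc i 1 x).pow 2)).add ((hc i 2 x).pow 2)).add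
      ((hc i 3 x).pow 2)).const_sub 1).mul (hyp i x))
    refine this.congr_deriv ?_
    fin_cases i <;> simp
  have hvz : ∀ x, x ∉ tsupport v → v x = 0 ∧ ∀ i, pderivE i v x = 0 := fun x hx =>
    ⟨image_eq_zero_of_notMem_tsupport hx, fun i => image_eq_zero_of_notMem_tsupport
      fun h => hx (tsupport_fderiv_apply_subset ℝ _ h)⟩
  -- the modified gradient
  set H : E4 → ℝ := fun x => ∑ i, (pderivE i v x + x i * y x) ^ 2 with hH
  have hHC : Continuous H := by simp only [hH]; fun_prop
  have hPC : Continuous (gradSq v) := by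
    rw [show gradSq v = fun x => ∑ i, pderivE i v x ^ 2 from rfl]; fun_prop
  have hvyc : IsCompact (tsupport v ∪ tsupport y) := hvc.isCompact.union hyc.isCompact
  have hzero : ∀ x, x ∉ tsupport v ∪ tsupport y → v x = 0 ∧ y x = 0 ∧ ∀ i, pderivE i v x = 0 :=
    fun x hx => ⟨(hvz x fun h => hx (Or.inl h)).1,
      image_eq_zero_of_notMem_tsupport fun h => hx (Or.inr h), (hvz x fun h => hx (Or.inl h)).2⟩
  have hI : ∀ g : E4 → ℝ, Continuous g →
      (∀ x, (v x = 0 ∧ y x = 0 ∧ ∀ i, pderivE i v x = 0) → g x = 0) → Integrable g :=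
    fun g hg h => integrable_of_cont hg
      (HasCompactSupport.intro hvyc fun x hx => h x (hzero x hx))
  have iH : Integrable H := hI _ hHC fun x ⟨h1, h2, h3⟩ => by simp [hH, h2, h3]
  have ity : Integrable fun x => (1 - ‖x‖ ^ 2) * y x ^ 2 :=
    hI _ (by fun_prop) fun x ⟨h1, h2, h3⟩ => by simp [h2]
  have iP : Integrable fun x => gradSq v x - y x ^ 2 :=
    hI _ (by fun_prop) fun x ⟨h1, h2, h3⟩ => by simp [gradSq, h2, h3]
  have iv2 : Integrable fun x => v x ^ 2 := hI _ (by fun_prop) fun x ⟨h1, h2, h3⟩ => by simp [h1]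
  have iv3 : Integrable fun x => |v x| ^ 3 := hI _ (by fun_prop) fun x ⟨h1, h2, h3⟩ => by simp [h1]
  have iv4 : Integrable fun x => v x ^ 4 := hI _ (by fun_prop) fun x ⟨h1, h2, h3⟩ => by simp [h1]
  have ivy : Integrable fun x => v x ^ 2 * |y x| :=
    hI _ (by fun_prop) fun x ⟨h1, h2, h3⟩ => by simp [h1]
  have ivH : Integrable fun x => v x ^ 2 * √(H x) :=
    hI _ (by fun_prop) fun x ⟨h1, h2, h3⟩ => by simp [h1]
  have ivP : Integrable fun x => v x ^ 2 * √(gradSq v x) :=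
    hI _ (by fun_prop) fun x ⟨h1, h2, h3⟩ => by simp [h1]
  have hH0 : ∀ x, 0 ≤ H x := fun x => Finset.sum_nonneg fun i _ => sq_nonneg _
  have hty0 : ∀ x, 0 ≤ (1 - ‖x‖ ^ 2) * y x ^ 2 := fun x => by
    rcases le_or_gt 1 ‖x‖ with h | h
    · simp [hy0 x h]
    · have : ‖x‖ ^ 2 ≤ 1 := by nlinarith [norm_nonneg x]
      exact mul_nonneg (by linarith) (sq_nonneg _)
  -- the quadratic form is `∫ H + 3 ∫ (1 - |x|²) y²`
  have hD : ∫ x, (gradSq v x - y x ^ 2) = (∫ x, H x) + 3 * ∫ x, (1 - ‖x‖ ^ 2) * y x ^ 2 := by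
    have hd : ∀ i x, HasDerivAt (fun s : ℝ => (fun x : E4 => x i * v x * y x)
        (x + s • EuclideanSpace.single i (1 : ℝ)))
        (v x * y x + 2 * x i * pderivE i v x * y x + 2 * x i ^ 2 * y x ^ 2) 0 := by
      intro i x
      refine (((hc i i x).mul (hp i x)).mul (hyp i x)).congr_deriv ?_
      simp [hpy, hvy]; ring
    have hd0 : ∀ i, ∫ x : E4, (v x * y x + 2 * x i * pderivE i v x * y x + 2 * x i ^ 2 *
        y x ^ 2) = 0 :=
      fun i => integral_hasLineDeriv_eq_zero (Y := fun x : E4 => x i * v x * y x) _ (by fun_prop)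
        (HasCompactSupport.intro hvyc fun x hx => by simp [hzero x hx])
        (hI _ (by fun_prop) fun x ⟨h1, h2, h3⟩ => by simp [h2]) (hd i)
    have hdI : ∀ i, Integrable fun x : E4 =>
        (v x * y x + 2 * x i * pderivE i v x * y x + 2 * x i ^ 2 * y x ^ 2) := fun i =>
      hI _ (by fun_prop) fun x ⟨h1, h2, h3⟩ => by simp [h2]
    rw [← integral_const_mul, ← integral_add iH (ity.const_mul 3)]
    have : ∀ x, H x + 3 * ((1 - ‖x‖ ^ 2) * y x ^ 2) = (gradSq v x - y x ^ 2)
        + ∑ i, (v x * y x + 2 * x i * pderivE i v x * y x + 2 * x i ^ 2 * y x ^ 2) := by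
      intro x
      simp only [hH, gradSq, Fin.sum_univ_four, hvy, norm_sq_E4]
      ring
    simp only [this]
    rw [integral_add iP (integrable_finsetSum _ fun i _ => hdI i),
      integral_finsetSum _ fun i _ => hdI i]
    simp [hd0]
  set D := ∫ x, (gradSq v x - y x ^ 2) with hDdef
  set X := ∫ x, v x ^ 4 with hX
  have hX0 : 0 ≤ X := integral_nonneg fun x => by positivity
  have hIH0 : 0 ≤ ∫ x, H x := integral_nonneg hH0
  have hIt0 : 0 ≤ ∫ x, (1 - ‖x‖ ^ 2) * y x ^ 2 := integral_nonneg hty0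
  have hD0 : 0 ≤ D := by rw [hD]; positivity
  have hv2D : ∫ x, v x ^ 2 ≤ ∫ x, (1 - ‖x‖ ^ 2) * y x ^ 2 := by
    refine integral_mono iv2 ity fun x => ?_
    have : v x ^ 2 = (1 - ‖x‖ ^ 2) * ((1 - ‖x‖ ^ 2) * y x ^ 2) := by rw [hvy]; ring
    dsimp only
    rw [this]
    nlinarith [hty0 x, sq_nonneg ‖x‖]
  have hnorm : ∀ x, |∑ i, x i * (pderivE i v x + x i * y x)| ≤ ‖x‖ * √(H x) := fun x => by
    refine abs_le_of_sq_le_sq ?_ (by positivity)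
    rw [mul_pow, Real.sq_sqrt (hH0 x), EuclideanSpace.real_norm_sq_eq]
    exact Finset.sum_mul_sq_le_sq_mul_sq _ _ _
  -- control of the boundary weight
  have hbdry : ∫ x, v x ^ 2 * |y x| ≤ 7 / 3 * (∫ x, |v x| ^ 3) + ∫ x, v x ^ 2 * √(H x) := by
    have hd : ∀ i x, HasDerivAt (fun s : ℝ => (fun x : E4 => x i * |v x| ^ 3)
        (x + s • EuclideanSpace.single i (1 : ℝ)))
        (|v x| ^ 3 + x i * (3 * |v x| * v x * pderivE i v x)) 0 := by
      intro i x
      refine ((hc i i x).mul (hasDerivAt_abs_cube (hp i x))).congr_deriv ?_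
      simp
    have hdI : ∀ i, Integrable fun x : E4 =>
        (|v x| ^ 3 + x i * (3 * |v x| * v x * pderivE i v x)) := fun i =>
      hI _ (by fun_prop) fun x ⟨h1, h2, h3⟩ => by simp [h1]
    have hd0 : ∀ i, ∫ x : E4, (|v x| ^ 3 + x i * (3 * |v x| * v x * pderivE i v x)) = 0 :=
      fun i => integral_hasLineDeriv_eq_zero (Y := fun x : E4 => x i * |v x| ^ 3) _ (by fun_prop)
        (HasCompactSupport.intro hvyc fun x hx => by simp [hzero x hx]) (hdI i) (hd i)
    have h0 : ∫ x, ∑ i, (|v x| ^ 3 + x i * (3 * |v x| * v x * pderivE i v x)) = 0 := by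
      rw [integral_finsetSum _ fun i _ => hdI i]; simp [hd0]
    have hle : ∀ x, 3 * (v x ^ 2 * |y x|) ≤ 7 * |v x| ^ 3 + 3 * (v x ^ 2 * √(H x))
        - ∑ i, (|v x| ^ 3 + x i * (3 * |v x| * v x * pderivE i v x)) := by
      intro x
      rcases le_or_gt 1 ‖x‖ with h | h
      · have : v x = 0 := by rw [hvy, hy0 x h, mul_zero]
        simp [this]
      have ht : 0 ≤ 1 - ‖x‖ ^ 2 := by nlinarith [norm_nonneg x]
      have hav : |v x| = (1 - ‖x‖ ^ 2) * |y x| := by rw [hvy, abs_mul, abs_of_nonneg ht]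
      have h1 : -(v x ^ 2 * √(H x)) ≤ |v x| * v x * ∑ i, x i * (pderivE i v x + x i * y x) ∧
        |v x| * v x * ∑ i, x i * (pderivE i v x + x i * y x) ≤ v x ^ 2 * √(H x) := by
        rw [← abs_le, abs_mul, abs_mul, abs_abs, ← pow_two, sq_abs]
        refine mul_le_mul_of_nonneg_left ((hnorm x).trans ?_) (sq_nonneg _)
        exact mul_le_of_le_one_left (Real.sqrt_nonneg _) h.le
      have h2 : |v x| * v x * (‖x‖ ^ 2 * y x) = v x ^ 2 * |y x| - |v x| ^ 3 := by
        rw [← sq_abs (v x), hav, hvy]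
        have : y x * y x = |y x| * |y x| := (abs_mul_abs_self _).symm
        linear_combination ((1 - ‖x‖ ^ 2) ^ 2 * ‖x‖ ^ 2 * |y x|) * this
      rw [norm_sq_E4] at h2
      simp only [Fin.sum_univ_four] at h1 ⊢
      nlinarith [h1.1, h1.2, h2]
    have hab : Integrable fun x => 7 * |v x| ^ 3 + 3 * (v x ^ 2 * √(H x)) :=
      (iv3.const_mul 7).add (ivH.const_mul 3)
    have := integral_mono (ivy.const_mul 3)
      (hab.sub (integrable_finsetSum Finset.univ fun i _ => hdI i)) hle
    simp only [Pi.sub_apply] at this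
    rw [integral_sub hab (integrable_finsetSum Finset.univ fun i _ => hdI i),
      integral_add (iv3.const_mul 7) (ivH.const_mul 3), h0, integral_const_mul, integral_const_mul,
      integral_const_mul] at this
    linarith
  have hgrad : ∫ x, v x ^ 2 * √(gradSq v x) ≤
      2 * (∫ x, v x ^ 2 * √(H x)) + 2 * ∫ x, v x ^ 2 * |y x| := by
    rw [← integral_const_mul, ← integral_const_mul,
        ← integral_add (ivH.const_mul 2) (ivy.const_mul 2)]
    refine integral_mono ivP ((ivH.const_mul 2).add (ivy.const_mul 2)) fun x => ?_
    rcases le_or_gt 1 ‖x‖ with h | h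
    · have : v x = 0 := by rw [hvy, hy0 x h, mul_zero]
      simp [this]
    have : √(gradSq v x) ≤ 2 * √(H x) + 2 * |y x| := by
      refine Real.sqrt_le_iff.2 ⟨by positivity, ?_⟩
      have h1 : gradSq v x ≤ 2 * H x + 2 * (‖x‖ ^ 2 * y x ^ 2) := by
        simp only [gradSq, hH, norm_sq_E4, Fin.sum_univ_four]
        nlinarith [sq_nonneg (pderivE 0 v x + 2 * x 0 * y x),
            sq_nonneg (pderivE 1 v x + 2 * x 1 * y x),
          sq_nonneg (pderivE 2 v x + 2 * x 2 * y x), sq_nonneg (pderivE 3 v x + 2 * x 3 * y x)]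
      have h2 : ‖x‖ ^ 2 * y x ^ 2 ≤ y x ^ 2 :=
        mul_le_of_le_one_left (sq_nonneg _) (by nlinarith [norm_nonneg x])
      nlinarith [Real.sq_sqrt (hH0 x), sq_abs (y x),
          mul_nonneg (Real.sqrt_nonneg (H x)) (abs_nonneg (y x)), hH0 x]
    dsimp only
    nlinarith [sq_nonneg (v x)]
  set G := ∫ x, v x ^ 2 * √(gradSq v x) with hGdef
  have hG0 : 0 ≤ G := integral_nonneg fun x => by positivity
  have hGle : ∀ s > 0, G ≤ s * (5 * X) + (5 * D) / s := by
    intro s hs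
    have h1 : ∫ x, v x ^ 2 * √(H x) ≤ s / 2 * X + 1 / (2 * s) * ∫ x, H x := by
      rw [hX, ← integral_const_mul, ← integral_const_mul,
        ← integral_add (iv4.const_mul _) (iH.const_mul _)]
      refine integral_mono ivH ((iv4.const_mul _).add (iH.const_mul _)) fun x => ?_
      have : s / 2 * v x ^ 4 + 1 / (2 * s) * H x - v x ^ 2 * √(H x)
          = (s * v x ^ 2 - √(H x)) ^ 2 / (2 * s) := by
        field_simp
        rw [sub_sq, mul_pow, Real.sq_sqrt (hH0 x)]; ring
      have : 0 ≤ (s * v x ^ 2 - √(H x)) ^ 2 / (2 * s) := by positivity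
      dsimp only; linarith
    have h2 : ∫ x, |v x| ^ 3 ≤ s / 2 * X + 1 / (2 * s) * ∫ x, v x ^ 2 := by
      rw [hX, ← integral_const_mul, ← integral_const_mul,
        ← integral_add (iv4.const_mul _) (iv2.const_mul _)]
      refine integral_mono iv3 ((iv4.const_mul _).add (iv2.const_mul _)) fun x => ?_
      have : s / 2 * v x ^ 4 + 1 / (2 * s) * v x ^ 2 - |v x| ^ 3
          = (s * v x ^ 2 - |v x|) ^ 2 / (2 * s) := by
        field_simp
        have : v x ^ 2 = |v x| ^ 2 := (sq_abs _).symm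
        rw [this]; ring
      have : 0 ≤ (s * v x ^ 2 - |v x|) ^ 2 / (2 * s) := by positivity
      dsimp only; linarith
    have h3 : G ≤ 4 * (∫ x, v x ^ 2 * √(H x)) + 14 / 3 * (∫ x, |v x| ^ 3) := by linarith
    have h4 : (1 / (2 * s)) * (4 * (∫ x, H x) + 14 / 3 * ∫ x, v x ^ 2) ≤ (1 / (2 * s)) *
        (10 * D) := by
      apply mul_le_mul_of_nonneg_left _ (by positivity)
      rw [hD]; linarith
    have h5 : (1 / (2 * s)) * (10 * D) = (5 * D) / s := by field_simp; ring
    have h6 := mul_nonneg hs.le hX0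
    linarith
  refine ⟨hD0, ?_⟩
  have hG2 : G ^ 2 ≤ 100 * (X * D) := by
    have := sq_le_of_forall_le hG0 (by positivity : 0 ≤ 5 * X) (by positivity : 0 ≤ 5 * D) hGle
    linarith
  have hfin : X ^ 3 ≤ K * (100 * (X * D)) ^ 2 := by
    refine (hS v hv hvc).trans ?_
    rw [show G ^ 4 = (G ^ 2) ^ 2 by ring]
    gcongr
  rcases hX0.eq_or_lt with h | h
  · rw [← h]; positivity
  · have h1 : X ≤ K * 10000 * D ^ 2 := by
      have : X * X ^ 2 ≤ (K * 10000 * D ^ 2) * X ^ 2 := by linarith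
      exact le_of_mul_le_mul_right this (by positivity)
    refine h1.trans ?_
    rw [mul_pow]
    gcongr
    have := Real.sq_sqrt hK
    nlinarith [Real.sqrt_nonneg K]

open Set Metric

/-- Integration of radial functions on `ℝ⁴` in polar coordinates. -/
theorem lintegral_radial {f : ℝ → ENNReal} (hf : Measurable f) :
    ∫⁻ x : E4, f ‖x‖ = ENNReal.ofReal (2 * π ^ 2) * ∫⁻ s in Ioi (0 : ℝ), ENNReal.ofReal (s ^ 3) *
        f s := by
  have hdim : Module.finrank ℝ E4 = 4 := by simp
  have hball : (volume : Measure E4) (ball 0 1) = ENNReal.ofReal (π ^ 2 / 2) := by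
    rw [InnerProductSpace.volume_ball_of_dim_even (k := 2) (by simp)]
    norm_num [Nat.factorial]
  calc
    ∫⁻ x : E4, f ‖x‖ = ∫⁻ x : ({(0)}ᶜ : Set E4), f (‖x.1‖) ∂((volume : Measure E4).comap (↑)) := by
      rw [lintegral_subtype_comap (measurableSet_singleton _).compl fun x : E4 ↦ f (‖x‖),
        restrict_compl_singleton]
    _ = ∫⁻ x, f x.2 ∂(volume : Measure E4).toSphere.prod (.volumeIoiPow 3) := by
      have h := (volume : Measure E4).measurePreserving_homeomorphUnitSphereProd.lintegral_comp_emb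
        (Homeomorph.measurableEmbedding _) (f ∘ Subtype.val ∘ Prod.snd)
      rw [hdim] at h
      simpa using h
    _ = ENNReal.ofReal (2 * π ^ 2) * ∫⁻ x : Ioi (0 : ℝ), f x ∂.volumeIoiPow 3 := by
      rw [lintegral_prod _ (by fun_prop)]
      simp only [lintegral_const, Measure.toSphere_apply_univ, hdim, hball]
      rw [mul_comm, show (2 * π ^ 2 : ℝ) = 4 * (π ^ 2 / 2) by ring,
        ENNReal.ofReal_mul (by norm_num)]
      norm_num
    _ = _ := by
      rw [Measure.volumeIoiPow, lintegral_withDensity_eq_lintegral_mul _ (by fun_prop) (by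
          fun_prop)]
      congr 1
      exact lintegral_subtype_comap measurableSet_Ioi fun a ↦ ENNReal.ofReal (a ^ 3) * f a

theorem lintegral_radial_ball {f : ℝ → ENNReal} (hf : Measurable f) (x : E4) (R : ℝ) :
    ∫⁻ z in ball x R, f ‖x - z‖ =
      ENNReal.ofReal (2 * π ^ 2) * ∫⁻ s in Ioo (0 : ℝ) R, ENNReal.ofReal (s ^ 3) * f s := by
  have h1 : ∫⁻ z in ball x R, f ‖x - z‖ = ∫⁻ z : E4, (Iio R).indicator f ‖z‖ := by
    rw [← lintegral_indicator measurableSet_ball, ← lintegral_sub_left_eq_self _ x]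
    refine lintegral_congr fun z => ?_
    by_cases h : ‖z‖ < R <;> simp [indicator, h]
  rw [h1, lintegral_radial (hf.indicator measurableSet_Iio)]
  congr 1
  rw [← Ioi_inter_Iio, inter_comm, ← setLIntegral_indicator measurableSet_Iio]
  refine lintegral_congr fun s => ?_
  by_cases h : s < R <;> simp [indicator, h]

/-- Integral of `f` over the annulus `{d ≤ |x - z| < R}` via an antiderivative of `s³ f(s)`. -/
theorem lintegral_radial_annulus {f F : ℝ → ℝ} {d R : ℝ} (hd : 0 ≤ d) (hdR : d ≤ R)
    (hf : Measurable f) (hf0 : ∀ s, 0 < s → 0 ≤ f s) (hFc : ContinuousOn F (Icc d R))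
    (hF : ∀ s ∈ Ioo d R, HasDerivAt F (s ^ 3 * f s) s) (x : E4) :
    ∫⁻ z in ball x R, {z | d ≤ ‖x - z‖}.indicator (fun z => ENNReal.ofReal (f ‖x - z‖)) z =
      ENNReal.ofReal (2 * π ^ 2 * (F R - F d)) := by
  have h1 := lintegral_radial_ball (f := (Ici d).indicator fun s => ENNReal.ofReal (f s))
    ((by fun_prop : Measurable fun s => ENNReal.ofReal (f s)).indicator measurableSet_Ici) x R
  have h2 : ∀ z, (Ici d).indicator (fun s => ENNReal.ofReal (f s)) ‖x - z‖ =
      {z | d ≤ ‖x - z‖}.indicator (fun z => ENNReal.ofReal (f ‖x - z‖)) z := fun z => by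
    simp [indicator]
  simp only [h2] at h1
  rw [h1, ENNReal.ofReal_mul (p := 2 * π ^ 2) (by positivity)]
  congr 1
  have hInt : IntervalIntegrable (fun s => s ^ 3 * f s) volume d R :=
    intervalIntegral.intervalIntegrable_deriv_of_nonneg (by rwa [uIcc_of_le hdR])
      (by simpa [hdR] using hF) (by
        simp only [hdR, inf_of_le_left, sup_of_le_right]
        exact fun s hs => mul_nonneg (pow_nonneg (hd.trans hs.1.le) 3) (hf0 s (hd.trans_lt hs.1)))
  have h3 := intervalIntegral.integral_eq_sub_of_hasDerivAt_of_le hdR hFc hF hInt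
  rw [← h3, intervalIntegral.integral_of_le hdR, ofReal_integral_eq_lintegral_ofReal
    ((intervalIntegrable_iff_integrableOn_Ioc_of_le hdR).1 hInt)]
  · have h4 : ∫⁻ s in Ioo 0 R, ENNReal.ofReal (s ^ 3) *
        (Ici d).indicator (fun s => ENNReal.ofReal (f s)) s
        = ∫⁻ s in Ioo 0 R, (Ici d).indicator (fun s => ENNReal.ofReal (s ^ 3 * f s)) s := by
      refine setLIntegral_congr_fun measurableSet_Ioo fun s hs => ?_
      by_cases h : d ≤ s <;> simp [indicator, h, ENNReal.ofReal_mul (pow_nonneg hs.1.le 3)]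
    rw [h4, setLIntegral_indicator measurableSet_Ici]
    refine setLIntegral_congr ?_
    rcases hd.eq_or_lt with rfl | hd
    · rw [inter_eq_right.2 fun s hs => hs.1.le]
      exact Ioo_ae_eq_Ioc
    · have : Ici d ∩ Ioo 0 R = Ico d R := by
        ext s; simp only [mem_inter_iff, mem_Ici, mem_Ioo, mem_Ico]
        constructor
        · rintro ⟨h, -, h'⟩; exact ⟨h, h'⟩
        · rintro ⟨h, h'⟩; exact ⟨h, hd.trans_le h, h'⟩
      rw [this]
      exact Ico_ae_eq_Ioc
  · filter_upwards [ae_restrict_mem measurableSet_Ioc] with s hs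
    exact mul_nonneg (pow_nonneg (hd.trans hs.1.le) 3) (hf0 s (hd.trans_lt hs.1))

theorem lintegral_ball_inv_pow (p : ℕ) (hp : p < 4) (x : E4) {R : ℝ} (hR : 0 ≤ R) :
    ∫⁻ z in ball x R, ENNReal.ofReal ((‖x - z‖ ^ p)⁻¹) =
      ENNReal.ofReal (2 * π ^ 2 / (4 - p) * R ^ (4 - p)) := by
  have h := lintegral_radial_annulus (f := fun s => (s ^ p)⁻¹)
    (F := fun s => s ^ (4 - p) / ((4 - p : ℕ) : ℝ)) le_rfl hR (by fun_prop) (fun s hs => by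
        positivity)
    (by fun_prop) (fun s hs => by
      have h4 : ((4 - p : ℕ) : ℝ) ≠ 0 := by
        simp only [ne_eq, Nat.cast_eq_zero]; omega
      refine ((hasDerivAt_pow (4 - p) s).div_const _).congr_deriv ?_
      have := hs.1.ne'
      field_simp
      rw [← pow_add]; congr 1; omega) x
  have h0 : ∀ z : E4, {z | 0 ≤ ‖x - z‖}.indicator (fun z => ENNReal.ofReal ((‖x - z‖ ^ p)⁻¹)) z
      = ENNReal.ofReal ((‖x - z‖ ^ p)⁻¹) := fun z => by simp
  simp only [h0] at h
  rw [h, Nat.cast_sub hp.le]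
  congr 1
  rw [zero_pow (by omega)]
  push_cast
  ring

theorem lintegral_annulus_inv_four (x : E4) {d R : ℝ} (hd : 0 < d) (hR : d ≤ R) :
    ∫⁻ z in ball x R, {z | d ≤ ‖x - z‖}.indicator (fun z => ENNReal.ofReal ((‖x - z‖ ^ 4)⁻¹)) z =
      ENNReal.ofReal (2 * π ^ 2 * log (R / d)) := by
  rw [lintegral_radial_annulus (f := fun s => (s ^ 4)⁻¹) (F := log) hd.le hR (by fun_prop)
    (fun s hs => by positivity)
    (continuousOn_log.mono fun s hs => (hd.trans_le hs.1).ne') (fun s hs => by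
      have := (hd.trans hs.1).ne'
      refine (hasDerivAt_log this).congr_deriv ?_
      field_simp) x, log_div (hd.trans_le hR).ne' hd.ne']

theorem volume_ball_E4 (x : E4) {R : ℝ} (hR : 0 ≤ R) :
    volume (ball x R) = ENNReal.ofReal (π ^ 2 / 2 * R ^ 4) := by
  have := lintegral_ball_inv_pow 0 (by norm_num) x hR
  simp only [pow_zero, inv_one, ENNReal.ofReal_one, lintegral_const, Measure.restrict_apply_univ,
    one_mul] at this
  rw [this]
  congr 1
  rw [Nat.sub_zero, Nat.cast_zero]; ring

/-- The truncated paraboloid `(1 - |z|²)₊`. -/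
noncomputable def paraboloid (z : E4) : ℝ := max (1 - ‖z‖ ^ 2) 0

theorem continuous_paraboloid : Continuous paraboloid := by unfold paraboloid; fun_prop

theorem paraboloid_nonneg (z : E4) : 0 ≤ paraboloid z := le_max_right _ _

theorem paraboloid_le_one (z : E4) : paraboloid z ≤ 1 :=
  max_le (by nlinarith [sq_nonneg ‖z‖]) zero_le_one

theorem paraboloid_eq_zero {z : E4} (hz : z ∉ Metric.closedBall (0 : E4) 1) : paraboloid z = 0 := by
  have : 1 < ‖z‖ := by simpa using hz
  exact max_eq_right (by nlinarith)

theorem hasDerivAt_paraboloid_cube (i : Fin 4) (z : E4) :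
    HasDerivAt (fun s : ℝ => paraboloid (z + s • EuclideanSpace.single i (1 : ℝ)) ^ 3)
      (-(6 * paraboloid z ^ 2 * z i)) 0 := by
  have h1 : HasDerivAt (fun s : ℝ => 1 - ‖z + s • EuclideanSpace.single i (1 : ℝ)‖ ^ 2)
      (-(2 * z i)) 0 := by
    have h := fun j => (hasDerivAt_coord_line i j z).pow 2
    have h4 := (((h 0).add (h 1)).add (h 2)).add (h 3)
    refine ((h4.const_sub 1).congr_deriv ?_).congr_of_eventuallyEq
      (Filter.Eventually.of_forall fun s => ?_)
    · fin_cases i <;> simp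
    · simp only [norm_sq_E4]; rfl
  have h2 := ((h1.pow 3).add (hasDerivAt_abs_cube h1)).div_const 2
  have e : ∀ a : ℝ, max a 0 = (a + |a|) / 2 := fun a => by
    rcases le_total a 0 with h | h
    · rw [max_eq_right h, abs_of_nonpos h]; ring
    · rw [max_eq_left h, abs_of_nonneg h]; ring
  refine (h2.congr_deriv ?_).congr_of_eventuallyEq (Filter.Eventually.of_forall fun s => ?_)
  · simp only [zero_smul, add_zero, paraboloid, e]
    have := sq_abs (1 - ‖z‖ ^ 2)
    norm_num
    linear_combination (3 / 2 * z i) * this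
  · simp only [paraboloid, e, Pi.add_apply, Pi.pow_apply]
    have := sq_abs (1 - ‖z + s • EuclideanSpace.single i (1 : ℝ)‖ ^ 2)
    linear_combination (3 / 8 * (1 - ‖z + s • EuclideanSpace.single i (1 : ℝ)‖ ^ 2)
      - 3 / 8 * |1 - ‖z + s • EuclideanSpace.single i (1 : ℝ)‖ ^ 2|) * this

theorem hasDerivAt_comp_ray {v : E4 → ℝ} (hv : ContDiff ℝ (⊤ : ℕ∞) v) (x z : E4) (ρ : ℝ) :
    HasDerivAt (fun ρ : ℝ => v (x + ρ • z)) (∑ i, z i * pderivE i v (x + ρ • z)) ρ := by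
  have h1 : HasDerivAt (fun ρ : ℝ => x + ρ • z) z ρ := by
    simpa using ((hasDerivAt_id ρ).smul_const z).const_add x
  refine ((hv.differentiable (by simp) (x + ρ • z)).hasFDerivAt.comp_hasDerivAt ρ h1).congr_deriv ?_
  have hz : z = ∑ i, z i • EuclideanSpace.single i (1 : ℝ) := by
    ext j; simp [Finset.sum_apply, Pi.single_apply]
  conv_lhs => arg 2; rw [hz]
  simp [pderivE, map_sum]

/-- Weighted means over shrinking balls: the derivative is the weighted mean of the Laplacian. -/
theorem hasDerivAt_weighted_mean {v : E4 → ℝ} (hv : ContDiff ℝ (⊤ : ℕ∞) v) (x : E4) (ρ : ℝ) :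
    HasDerivAt (fun ρ : ℝ => ∫ z in Metric.closedBall (0 : E4) 1,
        6 * paraboloid z ^ 2 * v (x + ρ • z))
      (ρ * ∫ z in Metric.closedBall (0 : E4) 1, paraboloid z ^ 3 * lapE v (x + ρ • z)) ρ := by
  have hpc := continuous_paraboloid
  have hp1 := fun i => contDiff_pderivE hv i
  have hp2 := fun i => contDiff_pderivE (hp1 i) i
  have hvC := hv.continuous
  have hp1C := fun i => (hp1 i).continuous
  have hp2C := fun i => (hp2 i).continuous
  have hcoord : ∀ i : Fin 4, Continuous fun z : E4 => z i := fun i => by fun_prop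
  have hK : IsCompact (Metric.closedBall (0 : E4) 1) := isCompact_closedBall _ _
  set F' : ℝ → E4 → ℝ := fun ρ z => 6 * paraboloid z ^ 2 * ∑ i, z i *
      pderivE i v (x + ρ • z) with hF'
  have hF'c : Continuous F'.uncurry := by
    simp only [hF', Function.uncurry_def]; fun_prop
  have hF'z : ∀ ρ, Continuous (F' ρ) := fun ρ => by simp only [hF']; fun_prop
  obtain ⟨B, hB⟩ := ((isCompact_Icc (a := ρ - 1) (b := ρ + 1)).prod hK).exists_bound_of_continuousOn
    hF'c.continuousOn
  have h := (hasDerivAt_integral_of_dominated_loc_of_deriv_le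
    (μ := volume.restrict (Metric.closedBall (0 : E4) 1)) (x₀ := ρ) (s := Set.Icc (ρ - 1) (ρ + 1))
    (F := fun ρ z => 6 * paraboloid z ^ 2 * v (x + ρ • z)) (F' := F') (bound := fun _ => B)
    (Icc_mem_nhds (by linarith) (by linarith))
    (Filter.Eventually.of_forall fun s => Continuous.aestronglyMeasurable (by fun_prop))
    ((by fun_prop : Continuous fun z => 6 * paraboloid z ^ 2 *
        v (x + ρ • z)).continuousOn.integrableOn_compact hK)
    (hF'z ρ).aestronglyMeasurable
    ((ae_restrict_mem Metric.isClosed_closedBall.measurableSet).mono fun z hz s hs =>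
      hB (s, z) ⟨hs, hz⟩)
    (integrableOn_const hK.measure_lt_top.ne)
    (ae_of_all _ fun z s _ => (hasDerivAt_comp_ray hv x z s).const_mul _)).2
  refine h.congr_deriv ?_
  have hd : ∀ i z, HasDerivAt (fun s : ℝ => (fun z : E4 => paraboloid z ^ 3 *
      pderivE i v (x + ρ • z))
      (z + s • EuclideanSpace.single i (1 : ℝ)))
      (-(6 * paraboloid z ^ 2 * z i) * pderivE i v (x + ρ • z)
        + paraboloid z ^ 3 * (ρ * pderivE i (pderivE i v) (x + ρ • z))) 0 := by
    intro i z
    have h1 : HasDerivAt (fun s : ℝ => pderivE i v (x +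
        ρ • (z + s • EuclideanSpace.single i (1 : ℝ))))
        (ρ * pderivE i (pderivE i v) (x + ρ • z)) 0 := by
      have h2 := (hp1 i).hasDerivAt_line (by simp) i (x + ρ • z)
      have h3 : HasDerivAt (fun s : ℝ => ρ * s) ρ 0 := by
          simpa using (hasDerivAt_id (0 : ℝ)).const_mul ρ
      have h2' : HasDerivAt (fun s : ℝ => pderivE i v (x + ρ • z +
          s • EuclideanSpace.single i (1 : ℝ)))
        (pderivE i (pderivE i v) (x + ρ • z)) (ρ * 0) := by simpa using h2
      have h4 := h2'.comp 0 h3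
      refine (h4.congr_deriv (mul_comm _ _)).congr_of_eventuallyEq
        (Filter.Eventually.of_forall fun s => ?_)
      simp [smul_add, smul_smul, add_assoc]
    refine ((hasDerivAt_paraboloid_cube i z).mul h1).congr_deriv ?_
    simp
  have hcs : ∀ g : E4 → ℝ, (∀ z, paraboloid z = 0 → g z = 0) → HasCompactSupport g := fun g hg =>
    HasCompactSupport.intro hK fun z hz => hg z (paraboloid_eq_zero hz)
  have hI : ∀ i, Integrable fun z => (-(6 * paraboloid z ^ 2 * z i) * pderivE i v (x + ρ • z)
        + paraboloid z ^ 3 * (ρ * pderivE i (pderivE i v) (x + ρ • z))) := fun i =>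
    integrable_of_cont (by fun_prop) (hcs _ fun z hz => by simp [hz])
  have h0 : ∀ i, ∫ z, (-(6 * paraboloid z ^ 2 * z i) * pderivE i v (x + ρ • z)
        + paraboloid z ^ 3 * (ρ * pderivE i (pderivE i v) (x + ρ • z))) = 0 := fun i =>
    integral_hasLineDeriv_eq_zero (Y := fun z => paraboloid z ^ 3 * pderivE i v (x + ρ • z)) _
      (by fun_prop) (hcs _ fun z hz => by simp [hz]) (hI i) (hd i)
  have hset : ∀ g : E4 → ℝ, (∀ z, paraboloid z = 0 → g z = 0) →
      ∫ z in Metric.closedBall (0 : E4) 1, g z = ∫ z, g z := fun g hg =>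
    setIntegral_eq_integral_of_forall_compl_eq_zero fun z hz => hg z (paraboloid_eq_zero hz)
  rw [hset _ fun z hz => by simp [hF', hz], hset _ fun z hz => by simp [hz], ← integral_const_mul,
    ← sub_eq_zero, ← integral_sub (integrable_of_cont (hF'z ρ) (hcs _ fun z hz => by
        simp [hF', hz]))
      (integrable_of_cont (by simp only [lapE_eq_sum]; fun_prop) (hcs _ fun z hz => by simp [hz]))]
  have hsum : ∀ z, F' ρ z - ρ * (paraboloid z ^ 3 * lapE v (x + ρ • z)) =
      -∑ i, (-(6 * paraboloid z ^ 2 * z i) * pderivE i v (x + ρ • z)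
        + paraboloid z ^ 3 * (ρ * pderivE i (pderivE i v) (x + ρ • z))) := by
    intro z
    simp only [hF', lapE_eq_sum, Fin.sum_univ_four]; ring
  simp only [hsum]
  rw [integral_neg, integral_finsetSum _ fun i _ => hI i, Finset.sum_eq_zero fun i _ => h0 i,
      neg_zero]

theorem paraboloid_eq_zero_of_one_le {z : E4} (hz : 1 ≤ ‖z‖) : paraboloid z = 0 :=
  max_eq_right (by nlinarith)

theorem integral_paraboloid_sq :
    ∫ z in closedBall (0 : E4) 1, 6 * paraboloid z ^ 2 = π ^ 2 / 2 := by
  have hpc := continuous_paraboloid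
  have h := lintegral_radial_annulus (f := fun s => 6 * (1 - s ^ 2) ^ 2)
    (F := fun s => 6 * (s ^ 4 / 4 - s ^ 6 / 3 + s ^ 8 / 8)) le_rfl zero_le_one (by fun_prop)
    (fun s hs => by positivity) (by fun_prop) (fun s hs => by
      have := (((((hasDerivAt_pow 4 s).div_const 4).sub ((hasDerivAt_pow 6 s).div_const 3)).add
        ((hasDerivAt_pow 8 s).div_const 8)).const_mul 6)
      refine this.congr_deriv ?_
      push_cast; ring) (0 : E4)
  rw [setIntegral_eq_integral_of_forall_compl_eq_zero fun z hz => by simp [paraboloid_eq_zero hz],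
    integral_eq_lintegral_of_nonneg_ae (ae_of_all _ fun z => by positivity)
      (Continuous.aestronglyMeasurable (by fun_prop))]
  have h2 : ∫⁻ z : E4, ENNReal.ofReal (6 * paraboloid z ^ 2) =
      ENNReal.ofReal (2 * π ^ 2 * (6 * ((1 : ℝ) ^ 4 / 4 - 1 ^ 6 / 3 + 1 ^ 8 / 8)
        - 6 * ((0 : ℝ) ^ 4 / 4 - 0 ^ 6 / 3 + 0 ^ 8 / 8))) := by
    rw [← h, ← lintegral_indicator measurableSet_ball]
    refine lintegral_congr fun z => ?_
    rcases lt_or_ge ‖z‖ 1 with hz | hz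
    · have : paraboloid z = 1 - ‖z‖ ^ 2 := max_eq_left (by nlinarith [norm_nonneg z])
      simp [indicator, hz, this]
    · simp [indicator, paraboloid_eq_zero_of_one_le hz, not_lt.2 hz]
  rw [h2, ENNReal.toReal_ofReal (by norm_num; positivity)]
  norm_num; ring

theorem lintegral_comp_add_smul {g : E4 → ENNReal} (hg : Measurable g) (x : E4) {ρ : ℝ}
    (hρ : 0 < ρ) :
    ∫⁻ z, g (x + ρ • z) = ENNReal.ofReal ((ρ ^ 4)⁻¹) * ∫⁻ z, g z := by
  have h1 : ∫⁻ z, g (x + ρ • z) = ∫⁻ w, g (x + w) ∂(Measure.map (ρ • ·) (volume : Measure E4)) :=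
    (lintegral_map (f := fun w => g (x + w)) (g := (ρ • ·)) (by fun_prop) (by fun_prop)).symm
  rw [h1, Measure.map_addHaar_smul _ hρ.ne', lintegral_smul_measure, lintegral_add_left_eq_self]
  simp [abs_of_pos hρ]

theorem lintegral_ray_kernel_le (z : E4) (hz : z ≠ 0) (r : ℝ) :
    ∫⁻ ρ in Ioc 0 r, ENNReal.ofReal ((ρ ^ 3)⁻¹ * paraboloid (ρ⁻¹ • z) ^ 3) ≤
      (ball (0 : E4) r).indicator (fun z => ENNReal.ofReal ((8 * ‖z‖ ^ 2)⁻¹)) z := by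
  have hd : 0 < ‖z‖ := norm_pos_iff.2 hz
  have hsmall : ∀ ρ, 0 < ρ → ρ ≤ ‖z‖ → paraboloid (ρ⁻¹ • z) = 0 := fun ρ h1 h2 => by
    refine paraboloid_eq_zero_of_one_le ?_
    rw [norm_smul, norm_inv, norm_of_nonneg h1.le, inv_mul_eq_div, one_le_div h1]
    exact h2
  have hbig : ∀ ρ, ‖z‖ ≤ ρ → paraboloid (ρ⁻¹ • z) = 1 - ‖z‖ ^ 2 / ρ ^ 2 := fun ρ h1 => by
    have hρ := hd.trans_le h1
    rw [paraboloid, norm_smul, norm_inv, norm_of_nonneg hρ.le, inv_mul_eq_div, div_pow]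
    refine max_eq_left ?_
    rw [sub_nonneg, div_le_one (by positivity)]
    gcongr
  rcases le_or_gt r ‖z‖ with h | h
  · rw [setLIntegral_congr_fun measurableSet_Ioc (g := fun _ => 0)
      fun ρ hρ => by simp [hsmall ρ hρ.1 (hρ.2.trans h)]]
    simp
  · have hI : Ioc 0 r = Ioc 0 ‖z‖ ∪ Ioc ‖z‖ r := (Ioc_union_Ioc_eq_Ioc hd.le h.le).symm
    have hder : ∀ ρ ∈ uIcc ‖z‖ r, HasDerivAt
        (fun ρ : ℝ => (8 * ‖z‖ ^ 2)⁻¹ * (1 - ‖z‖ ^ 2 / ρ ^ 2) ^ 4)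
        ((ρ ^ 3)⁻¹ * (1 - ‖z‖ ^ 2 / ρ ^ 2) ^ 3) ρ := fun ρ hρ => by
      rw [uIcc_of_le h.le] at hρ
      have hρ0 := (hd.trans_le hρ.1).ne'
      have h1 := ((((hasDerivAt_pow 2 ρ).inv (by positivity)).const_mul (‖z‖ ^ 2)).const_sub
          1).pow 4
      refine ((h1.const_mul ((8 * ‖z‖ ^ 2)⁻¹)).congr_deriv ?_).congr_of_eventuallyEq
        (Filter.Eventually.of_forall fun s => ?_)
      · simp only [Pi.inv_apply, Nat.add_one_sub_one, ← div_eq_mul_inv, show 4 - 1 = 3 from rfl]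
        push_cast
        field_simp
        ring
      · simp [div_eq_mul_inv]
    have hcont : ContinuousOn (fun ρ : ℝ => (ρ ^ 3)⁻¹ * (1 - ‖z‖ ^ 2 / ρ ^ 2) ^ 3)
        (uIcc ‖z‖ r) := by
      rw [uIcc_of_le h.le]
      have : ∀ ρ ∈ Icc ‖z‖ r, ρ ≠ 0 := fun ρ hρ => (hd.trans_le hρ.1).ne'
      exact (continuousOn_pow 3).inv₀ (fun ρ hρ => pow_ne_zero 3 (this ρ hρ)) |>.mul
        ((continuousOn_const.sub (continuousOn_const.div (continuousOn_pow 2)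
          fun ρ hρ => pow_ne_zero 2 (this ρ hρ))).pow 3)
    have hInt := hcont.intervalIntegrable (μ := volume)
    have hval := intervalIntegral.integral_eq_sub_of_hasDerivAt hder hInt
    calc _ = ∫⁻ ρ in Ioc ‖z‖ r, ENNReal.ofReal ((ρ ^ 3)⁻¹ * paraboloid (ρ⁻¹ • z) ^ 3) := by
          rw [hI, lintegral_union measurableSet_Ioc (Ioc_disjoint_Ioc_of_le le_rfl),
            setLIntegral_congr_fun measurableSet_Ioc (g := fun _ => 0)
            fun ρ hρ => by simp [hsmall ρ hρ.1 hρ.2]]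
          simp
      _ = ∫⁻ ρ in Ioc ‖z‖ r, ENNReal.ofReal ((ρ ^ 3)⁻¹ * (1 - ‖z‖ ^ 2 / ρ ^ 2) ^ 3) :=
          setLIntegral_congr_fun measurableSet_Ioc fun ρ hρ => by
            rw [hbig ρ hρ.1.le]
      _ = ENNReal.ofReal (∫ ρ in ‖z‖..r, (ρ ^ 3)⁻¹ * (1 - ‖z‖ ^ 2 / ρ ^ 2) ^ 3) := by
          rw [intervalIntegral.integral_of_le h.le, ofReal_integral_eq_lintegral_ofReal
            ((intervalIntegrable_iff_integrableOn_Ioc_of_le h.le).1 hInt)]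
          filter_upwards [ae_restrict_mem measurableSet_Ioc] with ρ hρ
          rw [← hbig ρ hρ.1.le]
          have := hd.trans hρ.1
          have := paraboloid_nonneg (ρ⁻¹ • z)
          simp only [Pi.zero_apply]
          positivity
      _ ≤ _ := by
          rw [hval, indicator_of_mem (by simpa using h)]
          apply ENNReal.ofReal_le_ofReal
          have h1 : (1 - ‖z‖ ^ 2 / r ^ 2) ^ 4 ≤ 1 := by
            rw [← hbig r h.le]
            exact pow_le_one₀ (paraboloid_nonneg _) (paraboloid_le_one _)
          have h2 : ‖z‖ ^ 2 / ‖z‖ ^ 2 = 1 := div_self (by positivity)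
          rw [h2]
          have h3 : 0 < (8 * ‖z‖ ^ 2)⁻¹ := by positivity
          nlinarith

/-- Pointwise bound of a smooth function by the Newtonian potential of its Laplacian on a ball. -/
theorem enorm_le_potential_add_mean {v : E4 → ℝ} (hv : ContDiff ℝ (⊤ : ℕ∞) v) (x : E4) {r : ℝ}
    (hr : 0 < r) :
    ‖v x‖ₑ ≤ (∫⁻ z in ball x r, ENNReal.ofReal ((4 * π ^ 2 * ‖x - z‖ ^ 2)⁻¹) * ‖lapE v z‖ₑ)
      + ENNReal.ofReal (12 / (π ^ 2 * r ^ 4)) * ∫⁻ z in ball x r, ‖v z‖ₑ := by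
  have hpc := continuous_paraboloid
  have hpm : Measurable paraboloid := hpc.measurable
  have hvC := hv.continuous
  have hLC : Continuous (lapE v) := (contDiff_lapE hv).continuous
  have hLm := hLC.measurable
  have hvm := hvC.measurable
  set M : ℝ → ℝ := fun ρ => ∫ z in closedBall (0 : E4) 1, 6 * paraboloid z ^ 2 *
      v (x + ρ • z) with hM
  set M' : ℝ → ℝ := fun ρ => ρ * ∫ z in closedBall (0 : E4) 1, paraboloid z ^ 3 * lapE v (x + ρ • z)
    with hM'
  have hM'c : Continuous M' := by
    refine continuous_id.mul (continuous_parametric_integral_of_continuous ?_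
      (isCompact_closedBall (0 : E4) 1))
    simp only [Function.uncurry_def]; fun_prop
  have hFTC : ∫ ρ in 0..r, M' ρ = M r - M 0 :=
    intervalIntegral.integral_eq_sub_of_hasDerivAt (fun ρ _ => hasDerivAt_weighted_mean hv x ρ)
      (hM'c.intervalIntegrable _ _)
  have hM0 : M 0 = π ^ 2 / 2 * v x := by
    simp only [hM, zero_smul, add_zero]
    rw [integral_mul_const, integral_paraboloid_sq]
  have hMr : ‖M r‖ₑ ≤ ENNReal.ofReal (6 / r ^ 4) * ∫⁻ z in ball x r, ‖v z‖ₑ := by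
    calc ‖M r‖ₑ ≤ ∫⁻ z in closedBall (0 : E4) 1, ‖6 * paraboloid z ^ 2 * v (x + r • z)‖ₑ :=
          enorm_integral_le_lintegral_enorm _
      _ ≤ ∫⁻ z, ‖6 * paraboloid z ^ 2 * v (x + r • z)‖ₑ := setLIntegral_le_lintegral _ _
      _ ≤ ∫⁻ z, ENNReal.ofReal 6 * (ball x r).indicator (fun z => ‖v z‖ₑ) (x + r • z) := by
          refine lintegral_mono fun z => ?_
          rcases lt_or_ge ‖z‖ 1 with hz | hz
          · have hmem : x + r • z ∈ ball x r := by
              simp only [mem_ball, dist_self_add_left, norm_smul, norm_of_nonneg hr.le]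
              nlinarith
            rw [indicator_of_mem hmem, enorm_mul]
            gcongr
            rw [Real.enorm_eq_ofReal (by positivity)]
            apply ENNReal.ofReal_le_ofReal
            nlinarith [paraboloid_nonneg z, paraboloid_le_one z]
          · simp [paraboloid_eq_zero_of_one_le hz]
      _ = _ := by
          rw [lintegral_const_mul' _ _ ENNReal.ofReal_ne_top,
            lintegral_comp_add_smul (hvm.enorm.indicator measurableSet_ball) x hr,
            lintegral_indicator measurableSet_ball, ← mul_assoc,
            ← ENNReal.ofReal_mul (by norm_num), div_eq_mul_inv]
  have hInt : ‖∫ ρ in 0..r, M' ρ‖ₑ ≤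
      ∫⁻ z in ball x r, ENNReal.ofReal ((8 * ‖x - z‖ ^ 2)⁻¹) * ‖lapE v z‖ₑ := by
    have hin : ∀ ρ ∈ Ioc 0 r, ‖M' ρ‖ₑ ≤
        ∫⁻ z, ENNReal.ofReal ((ρ ^ 3)⁻¹ * paraboloid (ρ⁻¹ • (z - x)) ^ 3) * ‖lapE v z‖ₑ := by
      intro ρ hρ
      have hρ0 := hρ.1
      calc ‖M' ρ‖ₑ ≤ ENNReal.ofReal ρ * ∫⁻ z in closedBall (0 : E4) 1,
              ‖paraboloid z ^ 3 * lapE v (x + ρ • z)‖ₑ := by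
            rw [hM', enorm_mul, Real.enorm_eq_ofReal hρ0.le]
            gcongr
            exact enorm_integral_le_lintegral_enorm _
        _ ≤ ENNReal.ofReal ρ * ∫⁻ z, ENNReal.ofReal (paraboloid (ρ⁻¹ • (x + ρ • z - x)) ^ 3)
              * ‖lapE v (x + ρ • z)‖ₑ := by
            refine mul_le_mul_right ?_ _
            refine (setLIntegral_le_lintegral _ _).trans_eq (lintegral_congr fun z => ?_)
            have := paraboloid_nonneg z
            rw [enorm_mul, Real.enorm_eq_ofReal (by positivity), add_sub_cancel_left, smul_smul,
              inv_mul_cancel₀ hρ0.ne', one_smul]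
        _ = _ := by
            rw [lintegral_comp_add_smul (g := fun y =>
                ENNReal.ofReal (paraboloid (ρ⁻¹ • (y - x)) ^ 3) * ‖lapE v y‖ₑ) (by fun_prop) x hρ0,
              ← mul_assoc, ← ENNReal.ofReal_mul hρ0.le, ← lintegral_const_mul _ (by fun_prop)]
            refine lintegral_congr fun z => ?_
            rw [← mul_assoc, ← ENNReal.ofReal_mul (by positivity)]
            congr 3
            field_simp
    calc ‖∫ ρ in 0..r, M' ρ‖ₑ ≤ ∫⁻ ρ in Ioc 0 r, ‖M' ρ‖ₑ := by
          rw [intervalIntegral.integral_of_le hr.le]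
          exact enorm_integral_le_lintegral_enorm _
      _ ≤ ∫⁻ ρ in Ioc 0 r, ∫⁻ z, ENNReal.ofReal ((ρ ^ 3)⁻¹ * paraboloid (ρ⁻¹ • (z - x)) ^ 3)
            * ‖lapE v z‖ₑ := setLIntegral_mono' measurableSet_Ioc hin
      _ = ∫⁻ z, (∫⁻ ρ in Ioc 0 r, ENNReal.ofReal ((ρ ^ 3)⁻¹ * paraboloid (ρ⁻¹ • (z - x)) ^ 3))
            * ‖lapE v z‖ₑ := by
          rw [lintegral_lintegral_swap (by
            refine Measurable.aemeasurable ?_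
            simp only [Function.uncurry_def]; fun_prop)]
          refine lintegral_congr fun z => ?_
          rw [lintegral_mul_const' _ _ enorm_ne_top]
      _ ≤ ∫⁻ z, (ball x r).indicator (fun z => ENNReal.ofReal ((8 * ‖x - z‖ ^ 2)⁻¹) *
          ‖lapE v z‖ₑ) z := by
          refine lintegral_mono_ae ?_
          filter_upwards [(volume : Measure E4).ae_ne x] with z hz
          refine (mul_le_mul_left (lintegral_ray_kernel_le (z - x) (sub_ne_zero.2 hz) r)
              _).trans_eq ?_
          by_cases h : ‖x - z‖ < r
          · simp [indicator, dist_eq_norm, norm_sub_rev z x, h]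
          · simp [indicator, dist_eq_norm, norm_sub_rev z x, h]
      _ = _ := lintegral_indicator measurableSet_ball _
  have hkey : v x = (π ^ 2 / 2)⁻¹ * (M r - ∫ ρ in 0..r, M' ρ) := by
    rw [hFTC, hM0]; field_simp; ring
  have hc : 0 ≤ (π ^ 2 / 2)⁻¹ := by positivity
  rw [hkey, enorm_mul, Real.enorm_eq_ofReal hc]
  calc _ ≤ ENNReal.ofReal ((π ^ 2 / 2)⁻¹) * ((ENNReal.ofReal (6 / r ^ 4) * ∫⁻ z in ball x r, ‖v z‖ₑ)
        + ∫⁻ z in ball x r, ENNReal.ofReal ((8 * ‖x - z‖ ^ 2)⁻¹) * ‖lapE v z‖ₑ) := by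
        gcongr
        exact enorm_sub_le.trans (add_le_add hMr hInt)
    _ = _ := by
        rw [mul_add, add_comm, ← mul_assoc, ← ENNReal.ofReal_mul hc,
          ← lintegral_const_mul _ (by fun_prop)]
        congr 1
        · refine lintegral_congr fun z => ?_
          rw [← mul_assoc, ← ENNReal.ofReal_mul hc]
          congr 2
          rw [← mul_inv]
          congr 1
          ring
        · congr 2
          field_simp
          norm_num

/-- The Newtonian kernel of `ℝ⁴` with a lower order correction, truncated at distance `r`. -/
noncomputable def truncKernel (r : ℝ) (x z : E4) : ENNReal :=
  (Iio r).indicator (fun a => ENNReal.ofReal ((4 * π ^ 2)⁻¹ * ((a ^ 2)⁻¹ + (r * a)⁻¹))) ‖x - z‖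

theorem measurable_truncKernel (r : ℝ) : Measurable fun p : E4 × E4 => truncKernel r p.1 p.2 :=
  ((by fun_prop : Measurable fun a : ℝ =>
    ENNReal.ofReal ((4 * π ^ 2)⁻¹ * ((a ^ 2)⁻¹ + (r * a)⁻¹))).indicator measurableSet_Iio).comp
    (by fun_prop : Measurable fun p : E4 × E4 => ‖p.1 - p.2‖)

theorem kernel_product_bound {a b d r : ℝ} (ha : 0 < a) (hb : 0 < b) (har : a < r) (hbr : b < r)
    (hd : 0 < d) (hab : d ≤ a + b) :
    ((a ^ 2)⁻¹ + (r * a)⁻¹) * ((b ^ 2)⁻¹ + (r * b)⁻¹) ≤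
      (if d ≤ a then 1 / 2 * ((a ^ 4)⁻¹ + 3 * (r⁻¹ * (a ^ 3)⁻¹)) else 16 * (d ^ 2)⁻¹ * (a ^ 2)⁻¹) +
      (if d ≤ b then 1 / 2 * ((b ^ 4)⁻¹ + 3 * (r⁻¹ * (b ^ 3)⁻¹)) else 16 * (d ^ 2)⁻¹ *
          (b ^ 2)⁻¹) := by
  have hr : 0 < r := ha.trans har
  have hsq : ∀ t : ℝ, 0 < t → t < r → ((t ^ 2)⁻¹ + (r * t)⁻¹) ^ 2 ≤ (t ^ 4)⁻¹ + 3 *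
      (r⁻¹ * (t ^ 3)⁻¹) := by
    intro t ht htr
    have h1 : r⁻¹ ≤ t⁻¹ := inv_anti₀ ht htr.le
    have h2 : 0 < t⁻¹ := inv_pos.2 ht
    have h3 : 0 < r⁻¹ := inv_pos.2 hr
    simp only [mul_inv, ← inv_pow]
    nlinarith [mul_nonneg (mul_nonneg h3.le (sq_nonneg t⁻¹)) (sub_nonneg.2 h1)]
  have hdouble : ∀ t : ℝ, 0 < t → t < r → (t ^ 2)⁻¹ + (r * t)⁻¹ ≤ 2 * (t ^ 2)⁻¹ := by
    intro t ht htr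
    have h1 : r⁻¹ ≤ t⁻¹ := inv_anti₀ ht htr.le
    have h2 : 0 < t⁻¹ := inv_pos.2 ht
    simp only [mul_inv, ← inv_pow]
    nlinarith
  have hfar : ∀ t : ℝ, d / 2 ≤ t → (t ^ 2)⁻¹ ≤ 4 * (d ^ 2)⁻¹ := by
    intro t ht
    have : (t ^ 2)⁻¹ ≤ ((d / 2) ^ 2)⁻¹ := by gcongr
    refine this.trans_eq ?_
    field_simp
    norm_num
  have hnear : ∀ s t : ℝ, 0 < s → s < r → 0 < t → t < r → d / 2 ≤ t →
      ((s ^ 2)⁻¹ + (r * s)⁻¹) * ((t ^ 2)⁻¹ + (r * t)⁻¹) ≤ 16 * (d ^ 2)⁻¹ * (s ^ 2)⁻¹ := by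
    intro s t hs hsr ht htr hdt
    calc _ ≤ (2 * (s ^ 2)⁻¹) * (2 * (4 * (d ^ 2)⁻¹)) := by
          gcongr
          · exact hdouble s hs hsr
          · exact (hdouble t ht htr).trans (mul_le_mul_of_nonneg_left (hfar t hdt) (by norm_num))
      _ = _ := by ring
  have hpos : ∀ t : ℝ, 0 < t →
      0 ≤ if d ≤ t then 1 / 2 * ((t ^ 4)⁻¹ + 3 * (r⁻¹ * (t ^ 3)⁻¹)) else 16 * (d ^ 2)⁻¹ *
          (t ^ 2)⁻¹ := by
    intro t ht
    split_ifs <;> positivity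
  by_cases h1 : d ≤ a ∧ d ≤ b
  · rw [if_pos h1.1, if_pos h1.2]
    nlinarith [hsq a ha har, hsq b hb hbr,
      sq_nonneg (((a ^ 2)⁻¹ + (r * a)⁻¹) - ((b ^ 2)⁻¹ + (r * b)⁻¹))]
  · rcases le_total a b with h | h
    · have had : ¬ d ≤ a := fun h' => h1 ⟨h', h'.trans h⟩
      refine le_add_of_le_of_nonneg ?_ (hpos b hb)
      rw [if_neg had]
      exact hnear a b ha har hb hbr (by linarith)
    · have hbd : ¬ d ≤ b := fun h' => h1 ⟨h'.trans h, h'⟩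
      refine le_add_of_nonneg_of_le (hpos a ha) ?_
      rw [if_neg hbd, mul_comm]
      exact hnear b a hb hbr ha har (by linarith)

theorem lintegral_half_kernel_le (x : E4) {d r : ℝ} (hd : 0 < d) (hdr : d < 2 * r) :
    ∫⁻ z in ball x r, ENNReal.ofReal (if d ≤ ‖x - z‖ then
        1 / 2 * ((‖x - z‖ ^ 4)⁻¹ + 3 * (r⁻¹ * (‖x - z‖ ^ 3)⁻¹))
        else 16 * (d ^ 2)⁻¹ * (‖x - z‖ ^ 2)⁻¹) ≤
      ENNReal.ofReal (π ^ 2 * log (2 * r / d) + 19 * π ^ 2) := by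
  have hr : 0 < r := by linarith
  have hlog : 0 ≤ log (2 * r / d) := log_nonneg (by rw [le_div_iff₀ hd]; linarith)
  have h4 : ∫⁻ z in ball x r, {z | d ≤ ‖x - z‖}.indicator
      (fun z => ENNReal.ofReal ((‖x - z‖ ^ 4)⁻¹)) z ≤
          ENNReal.ofReal (2 * π ^ 2 * log (2 * r / d)) := by
    rcases le_or_gt d r with h | h
    · rw [lintegral_annulus_inv_four x hd h]
      apply ENNReal.ofReal_le_ofReal
      have : log (r / d) ≤ log (2 * r / d) := by
        apply log_le_log (by positivity)
        gcongr; linarith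
      gcongr
    · rw [setLIntegral_congr_fun measurableSet_ball (g := fun _ => 0) fun z hz => ?_]
      · simp
      · have : ‖x - z‖ < r := by simpa [dist_eq_norm, norm_sub_rev] using hz
        simp [indicator, not_le.2 (this.trans h)]
  have h3 := lintegral_ball_inv_pow 3 (by norm_num) x hr.le
  have h2 := lintegral_ball_inv_pow 2 (by norm_num) x hd.le
  calc _ ≤ ∫⁻ z in ball x r, (ENNReal.ofReal (1 / 2) * {z | d ≤ ‖x - z‖}.indicator
          (fun z => ENNReal.ofReal ((‖x - z‖ ^ 4)⁻¹)) z
        + ENNReal.ofReal (3 / 2 * r⁻¹) * ENNReal.ofReal ((‖x - z‖ ^ 3)⁻¹)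
        + ENNReal.ofReal (16 * (d ^ 2)⁻¹) *
          (ball x d).indicator (fun z => ENNReal.ofReal ((‖x - z‖ ^ 2)⁻¹)) z) := by
        refine lintegral_mono fun z => ?_
        by_cases h : d ≤ ‖x - z‖
        · simp only [h, if_true, indicator, mem_ofPred_eq]
          refine le_add_of_le_of_nonneg ?_ zero_le
          rw [← ENNReal.ofReal_mul (by positivity), ← ENNReal.ofReal_mul (by positivity),
            ← ENNReal.ofReal_add (by positivity) (by positivity)]
          apply ENNReal.ofReal_le_ofReal
          apply le_of_eq; ring
        · have hm : z ∈ ball x d := by simpa [dist_eq_norm, norm_sub_rev] using h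
          rw [if_neg h, indicator_of_mem hm, ENNReal.ofReal_mul (by positivity)]
          exact le_add_of_nonneg_left zero_le
    _ = ENNReal.ofReal (1 / 2) * (∫⁻ z in ball x r, {z | d ≤ ‖x - z‖}.indicator
          (fun z => ENNReal.ofReal ((‖x - z‖ ^ 4)⁻¹)) z)
        + ENNReal.ofReal (3 / 2 * r⁻¹) * (∫⁻ z in ball x r, ENNReal.ofReal ((‖x - z‖ ^ 3)⁻¹))
        + ENNReal.ofReal (16 * (d ^ 2)⁻¹) *
          ∫⁻ z in ball x r, (ball x d).indicator (fun z => ENNReal.ofReal ((‖x - z‖ ^ 2)⁻¹)) z := by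
        have hset : MeasurableSet {z : E4 | d ≤ ‖x - z‖} :=
            measurableSet_le (by fun_prop) (by fun_prop)
        have m1 : Measurable ({z : E4 | d ≤ ‖x - z‖}.indicator
          (fun z => ENNReal.ofReal ((‖x - z‖ ^ 4)⁻¹))) := Measurable.indicator (by fun_prop) hset
        have m2 : Measurable ((ball x d).indicator (fun z => ENNReal.ofReal ((‖x - z‖ ^ 2)⁻¹))) :=
          Measurable.indicator (by fun_prop) measurableSet_ball
        rw [lintegral_add_left (by fun_prop), lintegral_add_left (by fun_prop),
          lintegral_const_mul _ (by fun_prop), lintegral_const_mul _ (by fun_prop),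
          lintegral_const_mul _ (by fun_prop)]
    _ ≤ ENNReal.ofReal (1 / 2) * ENNReal.ofReal (2 * π ^ 2 * log (2 * r / d))
        + ENNReal.ofReal (3 / 2 * r⁻¹) * ENNReal.ofReal (2 * π ^ 2 / (4 - (3 : ℕ)) * r ^ (4 - 3))
        + ENNReal.ofReal (16 * (d ^ 2)⁻¹) * ENNReal.ofReal (2 * π ^ 2 / (4 - (2 : ℕ)) *
            d ^ (4 - 2)) := by
        gcongr
        · exact h3.le
        · rw [← h2, ← lintegral_indicator (measurableSet_ball (x := x) (ε := d))]
          exact setLIntegral_le_lintegral _ _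
    _ = _ := by
        rw [← ENNReal.ofReal_mul (by positivity), ← ENNReal.ofReal_mul (by positivity),
          ← ENNReal.ofReal_mul (by positivity), ← ENNReal.ofReal_add (by positivity)
            (by norm_num; positivity), ← ENNReal.ofReal_add (by norm_num; positivity)
            (by norm_num; positivity)]
        congr 1
        norm_num
        field_simp
        ring

/-- The composition of the truncated kernel with itself has a logarithmic singularity. -/
theorem lintegral_truncKernel_mul_le {x y : E4} {r : ℝ} (hxy : x ≠ y) (hr : ‖x - y‖ < 2 * r) :
    ∫⁻ z, truncKernel r x z * truncKernel r y z ≤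
      ENNReal.ofReal ((8 * π ^ 2)⁻¹ * log (2 * r / ‖x - y‖) + 1) := by
  have hd : 0 < ‖x - y‖ := norm_pos_iff.2 (sub_ne_zero.2 hxy)
  have hlog : 0 ≤ log (2 * r / ‖x - y‖) := log_nonneg (by rw [le_div_iff₀ hd]; linarith)
  set d := ‖x - y‖ with hdd
  set g : ℝ → ℝ := fun a => if d ≤ a then 1 / 2 * ((a ^ 4)⁻¹ + 3 * (r⁻¹ * (a ^ 3)⁻¹))
        else 16 * (d ^ 2)⁻¹ * (a ^ 2)⁻¹ with hg
  have hr0 : 0 < r := by linarith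
  have hgm : Measurable g := Measurable.ite measurableSet_Ici (by fun_prop) (by fun_prop)
  have hg0 : ∀ a, 0 ≤ a → 0 ≤ g a := fun a ha => by simp only [hg]; split_ifs <;> positivity
  calc _ ≤ ∫⁻ z, ENNReal.ofReal ((16 * π ^ 4)⁻¹) *
        ((ball x r).indicator (fun z => ENNReal.ofReal (g ‖x - z‖)) z
        + (ball y r).indicator (fun z => ENNReal.ofReal (g ‖y - z‖)) z) := by
        refine lintegral_mono_ae ?_
        filter_upwards [(volume : Measure E4).ae_ne x, (volume : Measure E4).ae_ne y] with z hzx hzy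
        have ha : 0 < ‖x - z‖ := norm_pos_iff.2 (sub_ne_zero.2 hzx.symm)
        have hb : 0 < ‖y - z‖ := norm_pos_iff.2 (sub_ne_zero.2 hzy.symm)
        by_cases h1 : ‖x - z‖ < r
        swap; · simp [truncKernel, indicator, h1]
        by_cases h2 : ‖y - z‖ < r
        swap; · simp [truncKernel, indicator, h2]
        have hzx' : z ∈ ball x r := by simpa [dist_eq_norm, norm_sub_rev] using h1
        have hzy' : z ∈ ball y r := by simpa [dist_eq_norm, norm_sub_rev] using h2
        rw [indicator_of_mem hzx', indicator_of_mem hzy', truncKernel, truncKernel,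
          indicator_of_mem (mem_Iio.2 h1), indicator_of_mem (mem_Iio.2 h2),
          ← ENNReal.ofReal_mul (by positivity), ← ENNReal.ofReal_add (hg0 _ ha.le) (hg0 _ hb.le),
          ← ENNReal.ofReal_mul (by positivity)]
        apply ENNReal.ofReal_le_ofReal
        have htri : d ≤ ‖x - z‖ + ‖y - z‖ := by
          rw [norm_sub_rev y z]; exact norm_sub_le_norm_sub_add_norm_sub x z y
        have := kernel_product_bound ha hb h1 h2 hd htri
        have h3 : (16 * π ^ 4)⁻¹ = (4 * π ^ 2)⁻¹ * (4 * π ^ 2)⁻¹ := by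
          rw [← mul_inv]; congr 1; ring
        rw [mul_mul_mul_comm, h3]
        gcongr
    _ = ENNReal.ofReal ((16 * π ^ 4)⁻¹) * ((∫⁻ z in ball x r, ENNReal.ofReal (g ‖x - z‖))
        + ∫⁻ z in ball y r, ENNReal.ofReal (g ‖y - z‖)) := by
        rw [lintegral_const_mul' _ _ ENNReal.ofReal_ne_top, lintegral_add_left
          (Measurable.indicator (by fun_prop) measurableSet_ball),
          lintegral_indicator measurableSet_ball, lintegral_indicator measurableSet_ball]
    _ ≤ ENNReal.ofReal ((16 * π ^ 4)⁻¹) * (ENNReal.ofReal (π ^ 2 * log (2 * r / d) + 19 * π ^ 2)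
        + ENNReal.ofReal (π ^ 2 * log (2 * r / d) + 19 * π ^ 2)) := by
        gcongr
        · exact lintegral_half_kernel_le x hd hr
        · exact lintegral_half_kernel_le y hd hr
    _ ≤ _ := by
        rw [← ENNReal.ofReal_add (by positivity) (by positivity),
            ← ENNReal.ofReal_mul (by positivity)]
        apply ENNReal.ofReal_le_ofReal
        have h1 : (16 * π ^ 4)⁻¹ * (π ^ 2 * log (2 * r / d) + 19 * π ^ 2
            + (π ^ 2 * log (2 * r / d) + 19 * π ^ 2)) =
            (8 * π ^ 2)⁻¹ * log (2 * r / d) + 19 / (8 * π ^ 2) := by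
          field_simp; ring
        rw [h1]
        gcongr
        rw [div_le_one (by positivity)]
        nlinarith [pi_gt_three]

/-- Averages of the composed kernel over a set of measure `ρ⁴`. -/
theorem setLIntegral_truncKernel_comp_le {z₀ y : E4} {r ρ : ℝ} (hρ : 0 < ρ) (hρr : ρ ≤ 2 * r)
    (hy : y ∈ ball z₀ r) {E : Set E4} (hE : E ⊆ ball z₀ r)
    (hvol : volume E = ENNReal.ofReal (ρ ^ 4)) :
    ∫⁻ x in E, ∫⁻ z, truncKernel r x z * truncKernel r y z ≤
      ENNReal.ofReal (ρ ^ 4 * ((32 * π ^ 2)⁻¹ * log (16 * r ^ 4 / ρ ^ 4) + 2)) := by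
  have hr : 0 < r := by linarith
  have hlog : 0 ≤ log (2 * r / ρ) := log_nonneg (by rw [le_div_iff₀ hρ]; linarith)
  calc _ ≤ ∫⁻ x in E, (ENNReal.ofReal ((8 * π ^ 2)⁻¹ * log (2 * r / ρ) + 1)
        + ENNReal.ofReal ((8 * π ^ 2)⁻¹ * ρ ^ 2) *
          (ball y ρ).indicator (fun x => ENNReal.ofReal ((‖y - x‖ ^ 2)⁻¹)) x) := by
        refine setLIntegral_mono_ae (by
          refine Measurable.aemeasurable ?_
          exact measurable_const.add (measurable_const.mul
            ((by fun_prop : Measurable fun x => ENNReal.ofReal ((‖y - x‖ ^ 2)⁻¹)).indicator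
              measurableSet_ball))) ?_
        filter_upwards [(volume : Measure E4).ae_ne y] with x hxy hx
        have hlt : ‖x - y‖ < 2 * r := by
          have h1 := hE hx
          rw [← dist_eq_norm]
          calc dist x y ≤ dist x z₀ + dist y z₀ := dist_triangle_right _ _ _
            _ < 2 * r := by have := mem_ball.1 h1; have := mem_ball.1 hy; linarith
        refine (lintegral_truncKernel_mul_le hxy hlt).trans ?_
        have hd : 0 < ‖x - y‖ := norm_pos_iff.2 (sub_ne_zero.2 hxy)
        have hsplit : log (2 * r / ‖x - y‖) = log (2 * r / ρ) + log (ρ / ‖x - y‖) := by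
          rw [← log_mul (by positivity) (by positivity)]
          congr 1; field_simp
        by_cases h : ‖x - y‖ < ρ
        · have hm : x ∈ ball y ρ := by simpa [dist_eq_norm] using h
          rw [indicator_of_mem hm, ← ENNReal.ofReal_mul (by positivity),
            ← ENNReal.ofReal_add (by positivity) (by positivity)]
          apply ENNReal.ofReal_le_ofReal
          have h1 : 1 ≤ ρ / ‖x - y‖ := (one_le_div hd).2 h.le
          have h2 : log (ρ / ‖x - y‖) ≤ ρ ^ 2 * (‖y - x‖ ^ 2)⁻¹ := by
            have := log_le_sub_one_of_pos (by positivity : 0 < ρ / ‖x - y‖)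
            rw [norm_sub_rev y x, ← div_eq_mul_inv, ← div_pow]
            nlinarith
          have h3 := mul_le_mul_of_nonneg_left h2 (by positivity : 0 ≤ (8 * π ^ 2)⁻¹)
          rw [hsplit]; linarith
        · refine le_add_of_le_of_nonneg (ENNReal.ofReal_le_ofReal ?_) zero_le
          have h2 : log (ρ / ‖x - y‖) ≤ 0 :=
            log_nonpos (by positivity) ((div_le_one hd).2 (not_lt.1 h))
          have h3 := mul_le_mul_of_nonneg_left h2 (by positivity : 0 ≤ (8 * π ^ 2)⁻¹)
          rw [hsplit]; linarith
    _ ≤ ENNReal.ofReal ((8 * π ^ 2)⁻¹ * log (2 * r / ρ) + 1) * ENNReal.ofReal (ρ ^ 4)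
        + ENNReal.ofReal ((8 * π ^ 2)⁻¹ * ρ ^ 2) *
          ENNReal.ofReal (2 * π ^ 2 / (4 - (2 : ℕ)) * ρ ^ (4 - 2)) := by
        rw [lintegral_add_left measurable_const, lintegral_const, Measure.restrict_apply_univ, hvol,
          lintegral_const_mul' _ _ ENNReal.ofReal_ne_top]
        gcongr
        rw [← lintegral_ball_inv_pow 2 (by norm_num) y hρ.le,
            ← lintegral_indicator measurableSet_ball]
        exact setLIntegral_le_lintegral _ _
    _ ≤ _ := by
        rw [← ENNReal.ofReal_mul (by positivity), ← ENNReal.ofReal_mul (by positivity),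
          ← ENNReal.ofReal_add (by positivity) (by norm_num; positivity)]
        apply ENNReal.ofReal_le_ofReal
        have h1 : log (16 * r ^ 4 / ρ ^ 4) = 4 * log (2 * r / ρ) := by
          rw [show 16 * r ^ 4 / ρ ^ 4 = (2 * r / ρ) ^ 4 by rw [div_pow]; ring, log_pow]
          norm_num
        rw [h1]
        have h2 : (32 * π ^ 2)⁻¹ * (4 * log (2 * r / ρ)) = (8 * π ^ 2)⁻¹ * log (2 * r / ρ) := by
          field_simp; ring
        have h3 : (8 * π ^ 2)⁻¹ * ρ ^ 2 * (2 * π ^ 2 / (4 - (2 : ℕ)) * ρ ^ (4 - 2)) = ρ ^ 4 *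
            (1 / 8) := by
          norm_num; field_simp
        rw [h2, h3]
        nlinarith [pow_pos hρ 4]

theorem measurable_truncKernel_comp {α : Type*} [MeasurableSpace α] (r : ℝ) {f g : α → E4}
    (hf : Measurable f) (hg : Measurable g) : Measurable fun a => truncKernel r (f a) (g a) := by
  have h := (measurable_truncKernel r).comp (hf.prodMk hg)
  simp only [Function.comp_def] at h
  exact h

theorem sq_lintegral_mul_le {α : Type*} [MeasurableSpace α] {μ : Measure α} {f g : α → ENNReal}
    (hf : AEMeasurable f μ) (hg : AEMeasurable g μ) :
    (∫⁻ x, f x * g x ∂μ) ^ 2 ≤ (∫⁻ x, f x ^ 2 ∂μ) * ∫⁻ x, g x ^ 2 ∂μ := by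
  have h := ENNReal.lintegral_mul_le_Lp_mul_Lq μ (p := 2) (q := 2)
    (Real.holderConjugate_iff.2 (by norm_num)) hf hg
  have h2 := pow_le_pow_left' h 2
  simp only [Pi.mul_apply, mul_pow, ENNReal.rpow_two] at h2
  have e : ∀ a : ENNReal, (a ^ (1 / 2 : ℝ)) ^ 2 = a := fun a => by
    rw [← ENNReal.rpow_natCast, ← ENNReal.rpow_mul]; norm_num
  rwa [e, e] at h2

/-- The average over `E` of the truncated kernel. -/
noncomputable def avgKernel (r : ℝ) (E : Set E4) (z : E4) : ENNReal :=
  (volume E)⁻¹ * ∫⁻ x in E, truncKernel r x z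

theorem measurable_avgKernel (r : ℝ) (E : Set E4) : Measurable (avgKernel r E) :=
  measurable_const.mul (measurable_truncKernel r).lintegral_prod_left'

theorem volume_subset_ball {z₀ : E4} {r : ℝ} (hr : 0 < r) {E : Set E4} (hE : E ⊆ ball z₀ r) :
    volume E ≠ ⊤ ∧ (volume E).toReal ≤ 16 * r ^ 4 := by
  have h := measure_mono (μ := volume) hE
  rw [volume_ball_E4 z₀ hr.le] at h
  refine ⟨(h.trans_lt ENNReal.ofReal_lt_top).ne, ?_⟩
  refine (ENNReal.toReal_le_of_le_ofReal (by positivity) h).trans ?_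
  have : π ^ 2 / 2 ≤ 16 := by nlinarith [pi_lt_four, pi_pos]
  gcongr

theorem lintegral_avgKernel_mul_le {z₀ : E4} {r : ℝ} (hr : 0 < r) {E E' : Set E4}
    (hE : E ⊆ ball z₀ r) (hE' : E' ⊆ ball z₀ r) (h0 : volume E ≠ 0) (h0' : volume E' ≠ 0)
    (hm' : MeasurableSet E') :
    ∫⁻ z, avgKernel r E z * avgKernel r E' z ≤
      ENNReal.ofReal ((32 * π ^ 2)⁻¹ * log (16 * r ^ 4 / (volume E).toReal) + 2) := by
  obtain ⟨hfin, hle⟩ := volume_subset_ball hr hE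
  obtain ⟨hfin', -⟩ := volume_subset_ball hr hE'
  have hpos : 0 < (volume E).toReal := ENNReal.toReal_pos h0 hfin
  set μ := (volume E).toReal with hμ
  set ρ := μ ^ (1 / 4 : ℝ) with hρ
  have hρ4 : ρ ^ 4 = μ := by
    rw [hρ, ← Real.rpow_natCast, ← Real.rpow_mul hpos.le]; norm_num
  have hρpos : 0 < ρ := Real.rpow_pos_of_pos hpos _
  have hρr : ρ ≤ 2 * r := by
    refine le_of_pow_le_pow_left₀ (n := 4) (by norm_num) (by positivity) ?_
    rw [hρ4]; linarith [hle, show (2 * r) ^ 4 = 16 * r ^ 4 by ring]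
  have hvol : volume E = ENNReal.ofReal (ρ ^ 4) := by rw [hρ4, ENNReal.ofReal_toReal hfin]
  have hk := measurable_truncKernel r
  have hkz : ∀ z, Measurable fun x => truncKernel r x z :=
    fun z => measurable_truncKernel_comp r measurable_id measurable_const
  set T := (32 * π ^ 2)⁻¹ * log (16 * r ^ 4 / μ) + 2 with hT
  have hin : ∀ y ∈ E', ∫⁻ z, (∫⁻ x in E, truncKernel r x z) * truncKernel r y z ≤
      volume E * ENNReal.ofReal T := fun y hy => by
    have h1 := setLIntegral_truncKernel_comp_le hρpos hρr (hE' hy) hE hvol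
    rw [ENNReal.ofReal_mul (by positivity), ← hvol, hρ4] at h1
    refine le_trans (le_of_eq ?_) h1
    rw [lintegral_lintegral_swap (Measurable.aemeasurable (by
      have h2 : Measurable fun p : E4 × E4 => truncKernel r y p.2 :=
        measurable_truncKernel_comp r measurable_const measurable_snd
      exact hk.mul h2))]
    exact lintegral_congr fun z => (lintegral_mul_const _ (hkz z)).symm
  calc _ = (volume E)⁻¹ * (volume E')⁻¹ * ∫⁻ z, ∫⁻ y in E', (∫⁻ x in E, truncKernel r x z) *
      truncKernel r y z := by
        rw [← lintegral_const_mul' _ _ (ENNReal.mul_ne_top (ENNReal.inv_ne_top.2 h0)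
          (ENNReal.inv_ne_top.2 h0'))]
        refine lintegral_congr fun z => ?_
        rw [lintegral_const_mul _ (hkz z), avgKernel, avgKernel]
        ring
    _ = (volume E)⁻¹ * (volume E')⁻¹ * ∫⁻ y in E', ∫⁻ z, (∫⁻ x in E, truncKernel r x z) *
        truncKernel r y z := by
        congr 1
        rw [lintegral_lintegral_swap (Measurable.aemeasurable (by
          have h2 : Measurable fun p : E4 × E4 => truncKernel r p.2 p.1 :=
            measurable_truncKernel_comp r measurable_snd measurable_fst
          have h3 : Measurable fun p : E4 × E4 => ∫⁻ x in E, truncKernel r x p.1 :=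
            (hk.lintegral_prod_left' (μ := volume.restrict E)).comp measurable_fst
          exact h3.mul h2))]
    _ ≤ (volume E)⁻¹ * (volume E')⁻¹ * ∫⁻ y in E', volume E * ENNReal.ofReal T := by
        gcongr _ * ?_
        exact setLIntegral_mono' hm' hin
    _ = ((volume E)⁻¹ * volume E) * ((volume E')⁻¹ * volume E') * ENNReal.ofReal T := by
        rw [lintegral_const, Measure.restrict_apply_univ]; ring
    _ = ENNReal.ofReal T := by
        rw [ENNReal.inv_mul_cancel h0 hfin, ENNReal.inv_mul_cancel h0' hfin', one_mul, one_mul]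

theorem level_le_lintegral_avgKernel {r b s : ℝ} {w : E4 → ℝ} {F : E4 → ENNReal}
    (hF : Measurable F) {E : Set E4} (hEm : MeasurableSet E) (h0 : volume E ≠ 0)
        (hfin : volume E ≠ ⊤)
    (hrep : ∀ x ∈ E, ‖w x‖ₑ ≤ (∫⁻ z, truncKernel r x z * F z) + ENNReal.ofReal b)
    (hs : ∀ x ∈ E, s < |w x|) :
    ENNReal.ofReal s ≤ (∫⁻ z, avgKernel r E z * F z) + ENNReal.ofReal b := by
  have hk := measurable_truncKernel r
  have hkz : ∀ z, Measurable fun x => truncKernel r x z :=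
    fun z => measurable_truncKernel_comp r measurable_id measurable_const
  have h1 : ENNReal.ofReal s * volume E ≤
      (∫⁻ z, (∫⁻ x in E, truncKernel r x z) * F z) + ENNReal.ofReal b * volume E := by
    calc ENNReal.ofReal s * volume E = ∫⁻ x in E, ENNReal.ofReal s := by simp
      _ ≤ ∫⁻ x in E, ((∫⁻ z, truncKernel r x z * F z) + ENNReal.ofReal b) := by
          refine setLIntegral_mono' hEm fun x hx => le_trans ?_ (hrep x hx)
          rw [Real.enorm_eq_ofReal_abs]
          exact ENNReal.ofReal_le_ofReal (hs x hx).le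
      _ = (∫⁻ z, ∫⁻ x in E, truncKernel r x z * F z) + ENNReal.ofReal b * volume E := by
          rw [lintegral_add_right _ measurable_const, lintegral_const, Measure.restrict_apply_univ,
            lintegral_lintegral_swap (Measurable.aemeasurable
              (hk.mul (hF.comp measurable_snd)))]
      _ = _ := by
          congr 1
          exact lintegral_congr fun z => lintegral_mul_const _ (hkz z)
  calc ENNReal.ofReal s = (volume E)⁻¹ * (ENNReal.ofReal s * volume E) := by
        rw [mul_comm, mul_assoc, ENNReal.mul_inv_cancel h0 hfin, mul_one]
    _ ≤ (volume E)⁻¹ * ((∫⁻ z, (∫⁻ x in E, truncKernel r x z) * F z) + ENNReal.ofReal b *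
        volume E) := by
        gcongr
    _ = _ := by
        rw [mul_add, ← lintegral_const_mul' _ _ (ENNReal.inv_ne_top.2 h0)]
        congr 1
        · refine lintegral_congr fun z => ?_
          rw [avgKernel, mul_assoc]
        · rw [mul_comm, mul_assoc, ENNReal.mul_inv_cancel h0 hfin, mul_one]

/-- Garsia's two-level inequality for potentials of functions in the unit ball of `L²`. -/
theorem two_level_inequality {r b κ m s₁ s₂ : ℝ} {z₀ : E4} {w : E4 → ℝ} {F : E4 → ENNReal}
    (hr : 0 < r) (hw : Continuous w) (hF : Measurable F) (hb : 0 ≤ b) (hm : 0 ≤ m) (hκ : 0 < κ)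
    (hrep : ∀ x ∈ ball z₀ r, ‖w x‖ₑ ≤ (∫⁻ z, truncKernel r x z * F z) + ENNReal.ofReal b)
    (hF2 : ∫⁻ z, F z ^ 2 ≤ ENNReal.ofReal m) (hmb : m + κ * b ^ 2 ≤ 1) (hs₁ : 0 ≤ s₁) (hs : s₁ ≤ s₂)
    (hpos : volume {x | x ∈ ball z₀ r ∧ s₂ < |w x|} ≠ 0) :
    32 * π ^ 2 * (s₁ + s₂) ^ 2 ≤
      3 * log (16 * r ^ 4 / (volume {x | x ∈ ball z₀ r ∧ s₁ < |w x|}).toReal)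
      + log (16 * r ^ 4 / (volume {x | x ∈ ball z₀ r ∧ s₂ < |w x|}).toReal)
      + 32 * π ^ 2 * (8 + 4 / κ) := by
  set E : ℝ → Set E4 := fun s => {x | x ∈ ball z₀ r ∧ s < |w x|} with hE
  have hEb : ∀ s, E s ⊆ ball z₀ r := fun s x hx => hx.1
  have hEm : ∀ s, MeasurableSet (E s) := fun s =>
    measurableSet_ball.inter (measurableSet_lt measurable_const hw.abs.measurable)
  have hmono : volume (E s₂) ≤ volume (E s₁) :=
    measure_mono fun x hx => ⟨hx.1, hs.trans_lt hx.2⟩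
  have h2 : volume (E s₂) ≠ 0 := hpos
  have h1 : volume (E s₁) ≠ 0 := fun h => h2 (le_zero_iff.1 (h ▸ hmono))
  have hfin := fun s => (volume_subset_ball hr (hEb s)).1
  have hT0 : ∀ s, volume (E s) ≠ 0 → 0 ≤ log (16 * r ^ 4 / (volume (E s)).toReal) := fun s h => by
    apply log_nonneg
    rw [one_le_div (ENNReal.toReal_pos h (hfin s))]
    exact (volume_subset_ball hr (hEb s)).2
  have hlev : ∀ s, volume (E s) ≠ 0 → ENNReal.ofReal s ≤
      (∫⁻ z, avgKernel r (E s) z * F z) + ENNReal.ofReal b := fun s h =>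
    level_le_lintegral_avgKernel hF (hEm s) h (hfin s) (fun x hx => hrep x hx.1) (fun x hx => hx.2)
  set G : E4 → ENNReal := fun z => avgKernel r (E s₁) z + avgKernel r (E s₂) z with hG
  have hm1 := measurable_avgKernel r (E s₁)
  have hm2 := measurable_avgKernel r (E s₂)
  set T₁ := log (16 * r ^ 4 / (volume (E s₁)).toReal) with hT₁
  set T₂ := log (16 * r ^ 4 / (volume (E s₂)).toReal) with hT₂
  have hT₁0 : 0 ≤ T₁ := hT0 s₁ h1
  have hT₂0 : 0 ≤ T₂ := hT0 s₂ h2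
  set A := (32 * π ^ 2)⁻¹ * (3 * T₁ + T₂) + 8 with hA
  have hA0 : 0 ≤ A := by positivity
  have hGA : ∫⁻ z, G z ^ 2 ≤ ENNReal.ofReal A := by
    calc ∫⁻ z, G z ^ 2 = (∫⁻ z, avgKernel r (E s₁) z * avgKernel r (E s₁) z)
          + 2 * (∫⁻ z, avgKernel r (E s₁) z * avgKernel r (E s₂) z)
          + ∫⁻ z, avgKernel r (E s₂) z * avgKernel r (E s₂) z := by
          rw [← lintegral_const_mul _ (by fun_prop), ← lintegral_add_left (by fun_prop),
            ← lintegral_add_left (by fun_prop)]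
          exact lintegral_congr fun z => by simp only [hG]; ring
      _ ≤ ENNReal.ofReal ((32 * π ^ 2)⁻¹ * T₁ + 2) + 2 * ENNReal.ofReal ((32 * π ^ 2)⁻¹ * T₁ + 2)
          + ENNReal.ofReal ((32 * π ^ 2)⁻¹ * T₂ + 2) := by
          gcongr
          · exact lintegral_avgKernel_mul_le hr (hEb _) (hEb _) h1 h1 (hEm _)
          · exact lintegral_avgKernel_mul_le hr (hEb _) (hEb _) h1 h2 (hEm _)
          · exact lintegral_avgKernel_mul_le hr (hEb _) (hEb _) h2 h2 (hEm _)
      _ = ENNReal.ofReal A := by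
          rw [← ENNReal.ofReal_ofNat 2, ← ENNReal.ofReal_mul (by norm_num),
            ← ENNReal.ofReal_add (by positivity) (by positivity),
            ← ENNReal.ofReal_add (by positivity) (by positivity)]
          congr 1; rw [hA]; ring
  set I := ∫⁻ z, G z * F z with hI
  have hI2 : I ^ 2 ≤ ENNReal.ofReal (A * m) := by
    rw [ENNReal.ofReal_mul hA0]
    exact (sq_lintegral_mul_le (by fun_prop) hF.aemeasurable).trans (mul_le_mul' hGA hF2)
  have hIfin : I ≠ ⊤ := fun h => by simp [h] at hI2
  have hIA : I.toReal ^ 2 ≤ A * m := by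
    rw [← ENNReal.toReal_pow]
    exact ENNReal.toReal_le_of_le_ofReal (by positivity) hI2
  have hsum : s₁ + s₂ ≤ I.toReal + 2 * b := by
    have h := add_le_add (hlev s₁ h1) (hlev s₂ h2)
    have e : (∫⁻ z, avgKernel r (E s₁) z * F z) + ENNReal.ofReal b
        + ((∫⁻ z, avgKernel r (E s₂) z * F z) + ENNReal.ofReal b) =
        ENNReal.ofReal (I.toReal + 2 * b) := by
      rw [ENNReal.ofReal_add ENNReal.toReal_nonneg (by positivity), ENNReal.ofReal_toReal hIfin, hI,
        two_mul, ENNReal.ofReal_add hb hb]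
      simp only [hG, add_mul]
      rw [lintegral_add_left (by fun_prop)]
      ring
    rw [e, ← ENNReal.ofReal_add hs₁ (hs₁.trans hs)] at h
    exact (ENNReal.ofReal_le_ofReal_iff (by positivity)).1 h
  have hfinal : (s₁ + s₂) ^ 2 ≤ A + 4 / κ := by
    have hI0 : 0 ≤ I.toReal := ENNReal.toReal_nonneg
    have h3 : (s₁ + s₂) ^ 2 ≤ (I.toReal + 2 * b) ^ 2 :=
      pow_le_pow_left₀ (by linarith) hsum 2
    -- Cauchy–Schwarz in the plane
    have h4 : (√A * √m + 2 * b) ^ 2 ≤ (A + 4 / κ) * (m + κ * b ^ 2) := by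
      have e1 := Real.sq_sqrt hA0
      have e2 := Real.sq_sqrt hm
      have e3 : (A + 4 / κ) * (m + κ * b ^ 2) - (√A * √m + 2 * b) ^ 2 =
          (κ * √A * b - 2 * √m) ^ 2 / κ := by
        field_simp
        ring_nf
        rw [e1, e2]
        ring
      have : 0 ≤ (κ * √A * b - 2 * √m) ^ 2 / κ := by positivity
      linarith
    have h5 : I.toReal ≤ √A * √m := by
      rw [← Real.sqrt_mul hA0]; exact Real.le_sqrt_of_sq_le hIA
    have h6 : (I.toReal + 2 * b) ^ 2 ≤ (√A * √m + 2 * b) ^ 2 := by gcongr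
    have h7 : (A + 4 / κ) * (m + κ * b ^ 2) ≤ (A + 4 / κ) * 1 := by gcongr
    linarith
  have := mul_le_mul_of_nonneg_left hfinal (by positivity : 0 ≤ 32 * π ^ 2)
  refine this.trans (le_of_eq ?_)
  rw [hA]
  have : (32 * π ^ 2) * (32 * π ^ 2)⁻¹ = 1 := mul_inv_cancel₀ (by positivity)
  linear_combination (3 * T₁ + T₂) * this

theorem exists_peak {B c : ℝ} (hB : 0 < B) {ψ : ℝ → ℝ} (hψ : ∀ s, 0 ≤ ψ s)
    (h : ∀ s₁ s₂, 0 ≤ s₁ → s₁ ≤ s₂ → ψ s₁ ^ 3 * ψ s₂ ≤ B ^ 4 * exp (-(2 * c * s₁ * (s₂ - s₁)))) :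
    ∃ p, 1 ≤ p ∧ ∀ s, 1 ≤ s → ψ s ≤ 2 * B * exp (-(c / 2 * min s p * |s - p|)) := by
  have hbd : ∀ s, 1 ≤ s → ψ s ≤ B := fun s hs => by
    refine le_of_pow_le_pow_left₀ (n := 4) (by norm_num) hB.le ?_
    have := h s s (by linarith) le_rfl
    simp only [sub_self, mul_zero, neg_zero, exp_zero, mul_one] at this
    linarith [show ψ s ^ 4 = ψ s ^ 3 * ψ s by ring]
  by_cases h0 : ∀ s, 1 ≤ s → ψ s = 0
  · exact ⟨1, le_rfl, fun s hs => by rw [h0 s hs]; positivity⟩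
  push Not at h0
  obtain ⟨q, hq, hq0⟩ := h0
  have hbdd : BddAbove (ψ '' Ici 1) := ⟨B, by rintro _ ⟨s, hs, rfl⟩; exact hbd s hs⟩
  have hqS : ψ q ≤ sSup (ψ '' Ici 1) := le_csSup hbdd ⟨q, hq, rfl⟩
  have hS : 0 < sSup (ψ '' Ici 1) := lt_of_lt_of_le (lt_of_le_of_ne (hψ q) hq0.symm) hqS
  obtain ⟨_, ⟨p, hp, rfl⟩, hpS⟩ := exists_lt_of_lt_csSup ((nonempty_Ici).image ψ) (half_lt_self hS)
  have hp2 : ∀ s, 1 ≤ s → ψ s ≤ 2 * ψ p := fun s hs => by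
    linarith [le_csSup hbdd ⟨s, hs, rfl⟩]
  have hp1 : 1 ≤ p := hp
  refine ⟨p, hp1, fun s hs => le_of_pow_le_pow_left₀ (n := 4) (by norm_num) (by positivity) ?_⟩
  have hexp : (2 * B * exp (-(c / 2 * min s p * |s - p|))) ^ 4
      = 16 * (B ^ 4 * exp (-(2 * c * min s p * |s - p|))) := by
    rw [mul_pow, mul_pow, ← Real.exp_nat_mul]
    push_cast
    ring_nf
  rw [hexp]
  have hs0 := hψ s
  rcases le_total s p with hsp | hsp
  · rw [min_eq_left hsp, abs_sub_comm, abs_of_nonneg (sub_nonneg.2 hsp)]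
    have h1 := h s p (by linarith) hsp
    have h2 := mul_le_mul_of_nonneg_left (hp2 s hs) (pow_nonneg hs0 3)
    have h3 : 0 ≤ B ^ 4 * exp (-(2 * c * s * (p - s))) := by positivity
    linarith [show ψ s ^ 4 = ψ s ^ 3 * ψ s by ring]
  · rw [min_eq_right hsp, abs_of_nonneg (sub_nonneg.2 hsp)]
    have h1 := h p s (by linarith) hsp
    have h2 := mul_le_mul_of_nonneg_right (pow_le_pow_left₀ hs0 (hp2 s hs) 3) hs0
    have h3 : 0 ≤ B ^ 4 * exp (-(2 * c * p * (s - p))) := by positivity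
    linarith [show ψ s ^ 4 = ψ s ^ 3 * ψ s by ring, mul_pow 2 (ψ p) 3]

theorem mul_exp_peak_le {c s p : ℝ} (hc : 4 ≤ c) (hs : 1 ≤ s) (hp : 1 ≤ p) :
    s * exp (-(c / 2 * min s p * |s - p|)) ≤
      p * exp (-(c / 4) * |p * (s - p)|) + s * exp (-(c / 2) * s ^ 2) := by
  have hp0 : 0 < p := by linarith
  rw [abs_mul, abs_of_pos hp0]
  rcases le_total p s with hps | hps
  · refine le_add_of_le_of_nonneg ?_ (by positivity)
    rw [min_eq_right hps, abs_of_nonneg (sub_nonneg.2 hps)]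
    have h1 : s ≤ p * exp (c / 4 * (p * (s - p))) := by
      have h2 := add_one_le_exp (c / 4 * (p * (s - p)))
      have h3 : (s - p) ≤ c / 4 * (p * (s - p)) := by
        have : 1 * (1 * (s - p)) ≤ c / 4 * (p * (s - p)) := by
          gcongr; linarith
        linarith
      nlinarith [mul_le_mul_of_nonneg_left h2 hp0.le]
    calc _ ≤ p * exp (c / 4 * (p * (s - p))) * exp (-(c / 2 * p * (s - p))) := by gcongr
      _ = _ := by rw [mul_assoc, ← Real.exp_add]; ring_nf
  rw [min_eq_left hps, abs_sub_comm, abs_of_nonneg (sub_nonneg.2 hps)]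
  rcases le_total (p / 2) s with h | h
  · refine le_add_of_le_of_nonneg ?_ (by positivity)
    gcongr
    have := mul_le_mul_of_nonneg_right h (sub_nonneg.2 hps)
    nlinarith
  · refine le_add_of_nonneg_of_le (by positivity) ?_
    gcongr
    have : s * s ≤ s * (p - s) := by gcongr; linarith
    nlinarith

theorem lintegral_peak (c p : ℝ) (hc : 0 < c) (hp : 0 < p) :
    ∫⁻ s, ENNReal.ofReal (p * exp (-c * |p * (s - p)|)) = ENNReal.ofReal (∫ x, exp (-c * |x|)) := by
  have hi : Integrable fun x : ℝ => exp (-c * |x|) := by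
    have h1 := (integrable_inv_one_add_sq.const_mul 2).comp_mul_left' hc.ne'
    refine h1.mono' (by fun_prop) (ae_of_all _ fun x => ?_)
    rw [Real.norm_of_nonneg (exp_pos _).le, neg_mul, Real.exp_neg, ← div_eq_mul_inv,
      inv_le_comm₀ (exp_pos _) (by positivity), inv_div]
    have h2 := Real.quadratic_le_exp_of_nonneg (by positivity : 0 ≤ c * |x|)
    have h3 : (c * |x|) ^ 2 = (c * x) ^ 2 := by rw [mul_pow, mul_pow, sq_abs]
    have h4 : 0 ≤ c * |x| := by positivity
    linarith
  have h2 : Integrable fun s : ℝ => p * exp (-c * |p * (s - p)|) :=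
    ((hi.comp_mul_left' hp.ne').comp_sub_right p).const_mul p
  rw [← ofReal_integral_eq_lintegral_ofReal h2 (ae_of_all _ fun s => by positivity)]
  congr 1
  rw [integral_const_mul, integral_sub_right_eq_self (fun s => exp (-c * |p * s|)) p,
    Measure.integral_comp_mul_left (fun x => exp (-c * |x|)) p, abs_of_pos (inv_pos.2 hp),
        smul_eq_mul,
    mul_inv_cancel_left₀ hp.ne']

theorem exists_lintegral_mul_le {B c : ℝ} (hB : 0 < B) (hc : 4 ≤ c) :
    ∃ K : ℝ, 0 < K ∧ ∀ ψ : ℝ → ℝ, (∀ s, 0 ≤ ψ s) →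
      (∀ s₁ s₂, 0 ≤ s₁ → s₁ ≤ s₂ → ψ s₁ ^ 3 * ψ s₂ ≤ B ^ 4 * exp (-(2 * c * s₁ * (s₂ - s₁)))) →
      ∫⁻ s in Ioi 0, ENNReal.ofReal (s * ψ s) ≤ ENNReal.ofReal K := by
  set I₁ := ∫ x : ℝ, exp (-(c / 4) * |x|)
  set I₂ := ∫ s in Ioi (0 : ℝ), s * exp (-(c / 2) * s ^ 2)
  have hI₁ : 0 ≤ I₁ := integral_nonneg fun x => by positivity
  have hI₂ : 0 ≤ I₂ := setIntegral_nonneg measurableSet_Ioi fun s hs => by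
    have : 0 < s := hs
    positivity
  refine ⟨B + 2 * B * (I₁ + I₂), by positivity, fun ψ hψ h => ?_⟩
  obtain ⟨p, hp, hpk⟩ := exists_peak hB hψ h
  have hbd : ∀ s, 0 ≤ s → ψ s ≤ B := fun s hs => by
    refine le_of_pow_le_pow_left₀ (n := 4) (by norm_num) hB.le ?_
    have := h s s hs le_rfl
    simp only [sub_self, mul_zero, neg_zero, exp_zero, mul_one] at this
    linarith [show ψ s ^ 4 = ψ s ^ 3 * ψ s by ring]
  have hpt : ∀ s ∈ Ioi (0 : ℝ), ENNReal.ofReal (s * ψ s) ≤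
      (Ioc 0 1).indicator (fun _ => ENNReal.ofReal B) s +
      ENNReal.ofReal (2 * B) * (ENNReal.ofReal (p * exp (-(c / 4) * |p * (s - p)|)) +
        ENNReal.ofReal (s * exp (-(c / 2) * s ^ 2))) := by
    intro s hs
    have hs0 : 0 < s := hs
    rcases le_total s 1 with h1 | h1
    · refine le_add_of_le_of_nonneg ?_ (by positivity)
      rw [indicator_of_mem (show s ∈ Ioc 0 1 from ⟨hs0, h1⟩)]
      refine ENNReal.ofReal_le_ofReal ?_
      nlinarith [hbd s hs0.le, hψ s]
    · refine le_add_of_nonneg_of_le (by positivity) ?_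
      rw [← ENNReal.ofReal_add (by positivity) (by positivity),
          ← ENNReal.ofReal_mul (by positivity)]
      refine ENNReal.ofReal_le_ofReal ?_
      calc s * ψ s ≤ s * (2 * B * exp (-(c / 2 * min s p * |s - p|))) := by
            gcongr; exact hpk s h1
        _ = 2 * B * (s * exp (-(c / 2 * min s p * |s - p|))) := by ring
        _ ≤ _ := by gcongr; exact mul_exp_peak_le hc h1 hp
  have hgauss : ∫⁻ s in Ioi (0 : ℝ), ENNReal.ofReal (s * exp (-(c / 2) * s ^ 2)) =
      ENNReal.ofReal I₂ := by
    rw [← ofReal_integral_eq_lintegral_ofReal (integrable_mul_exp_neg_mul_sq (by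
        linarith)).integrableOn]
    refine (ae_restrict_iff' measurableSet_Ioi).2 (ae_of_all _ fun s hs => ?_)
    have : 0 < s := hs
    positivity
  calc _ ≤ ∫⁻ s in Ioi (0 : ℝ), ((Ioc 0 1).indicator (fun _ => ENNReal.ofReal B) s +
      ENNReal.ofReal (2 * B) * (ENNReal.ofReal (p * exp (-(c / 4) * |p * (s - p)|)) +
        ENNReal.ofReal (s * exp (-(c / 2) * s ^ 2)))) := setLIntegral_mono' measurableSet_Ioi hpt
    _ = (∫⁻ s in Ioi (0 : ℝ), (Ioc 0 1).indicator (fun _ => ENNReal.ofReal B) s) +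
      ENNReal.ofReal (2 * B) * ((∫⁻ s in Ioi (0 : ℝ),
          ENNReal.ofReal (p * exp (-(c / 4) * |p * (s - p)|))) +
        ∫⁻ s in Ioi (0 : ℝ), ENNReal.ofReal (s * exp (-(c / 2) * s ^ 2))) := by
        rw [lintegral_add_left (measurable_const.indicator measurableSet_Ioc),
          lintegral_const_mul _ (by fun_prop), lintegral_add_left (by fun_prop)]
    _ ≤ ENNReal.ofReal B + ENNReal.ofReal (2 * B) * (ENNReal.ofReal I₁ + ENNReal.ofReal I₂) := by
        rw [hgauss, ← lintegral_peak (c / 4) p (by linarith) (by linarith)]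
        refine add_le_add ?_ (mul_le_mul' le_rfl (add_le_add (setLIntegral_le_lintegral _ _)
            le_rfl))
        refine (setLIntegral_le_lintegral _ _).trans ?_
        rw [lintegral_indicator measurableSet_Ioc]
        simp
    _ = _ := by
        rw [← ENNReal.ofReal_add hI₁ hI₂, ← ENNReal.ofReal_mul (by positivity),
          ← ENNReal.ofReal_add hB.le (by positivity)]

theorem exists_lintegral_exp_le {κ : ℝ} (hκ : 0 < κ) :
    ∃ K : ℝ, 0 < K ∧ ∀ (r b m : ℝ) (z₀ : E4) (w : E4 → ℝ) (F : E4 → ENNReal), 0 < r →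
      Continuous w → Measurable F → 0 ≤ b → 0 ≤ m →
      (∀ x ∈ ball z₀ r, ‖w x‖ₑ ≤ (∫⁻ z, truncKernel r x z * F z) + ENNReal.ofReal b) →
      ∫⁻ z, F z ^ 2 ≤ ENNReal.ofReal m → m + κ * b ^ 2 ≤ 1 →
      ∫⁻ x in ball z₀ r, ENNReal.ofReal (exp (32 * π ^ 2 * w x ^ 2) - 1) ≤
        ENNReal.ofReal (K * r ^ 4) := by
  set c := 32 * π ^ 2 with hc
  have hc4 : 4 ≤ c := by nlinarith [pi_gt_three]
  set B := exp (c * (8 + 4 / κ) / 4) with hB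
  obtain ⟨K, hK, hKψ⟩ := exists_lintegral_mul_le (B := B) (exp_pos _) hc4
  refine ⟨2 * c * 16 * K, by positivity, fun r b m z₀ w F hr hw hF hb hm hrep hF2 hmb => ?_⟩
  set E : ℝ → Set E4 := fun s => {x | x ∈ ball z₀ r ∧ s < |w x|} with hE
  have hfin : ∀ s, volume (E s) ≠ ⊤ := fun s => (volume_subset_ball hr fun x hx => hx.1).1
  set ψ : ℝ → ℝ := fun s => (volume (E s)).toReal * exp (c * s ^ 2) / (16 * r ^ 4) with hψ
  have hψ0 : ∀ s, 0 ≤ ψ s := fun s => by positivity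
  have hlog : ∀ s, volume (E s) ≠ 0 →
      ψ s = exp (c * s ^ 2 - log (16 * r ^ 4 / (volume (E s)).toReal)) := fun s h => by
    have := ENNReal.toReal_pos h (hfin s)
    rw [Real.exp_sub, exp_log (by positivity), hψ]
    field_simp
  have hmain : ∀ s₁ s₂, 0 ≤ s₁ → s₁ ≤ s₂ →
      ψ s₁ ^ 3 * ψ s₂ ≤ B ^ 4 * exp (-(2 * c * s₁ * (s₂ - s₁))) := by
    intro s₁ s₂ h1 h2
    by_cases h0 : volume (E s₂) = 0
    · have : ψ s₂ = 0 := by simp [hψ, h0]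
      rw [this, mul_zero]; positivity
    have h0' : volume (E s₁) ≠ 0 := fun h => h0 (le_zero_iff.1
      (h ▸ measure_mono fun x hx => ⟨hx.1, h2.trans_lt hx.2⟩))
    have h3 := two_level_inequality hr hw hF hb hm hκ hrep hF2 hmb h1 h2 h0
    rw [hlog _ h0, hlog _ h0', hB, ← Real.exp_nat_mul, ← Real.exp_nat_mul, ← Real.exp_add,
        ← Real.exp_add]
    refine exp_le_exp.2 ?_
    push_cast
    rw [← hc] at h3
    change c * (s₁ + s₂) ^ 2 ≤ 3 * log (16 * r ^ 4 / (volume (E s₁)).toReal) +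
      log (16 * r ^ 4 / (volume (E s₂)).toReal) + c * (8 + 4 / κ) at h3
    linear_combination h3
  have hderiv : ∀ t : ℝ, HasDerivAt (fun t => exp (c * t ^ 2)) (2 * c * t * exp (c * t ^ 2)) t := by
    intro t
    have := ((hasDerivAt_pow 2 t).const_mul c).exp
    convert this using 1
    push_cast; ring
  have hcont : Continuous fun t : ℝ => 2 * c * t * exp (c * t ^ 2) := by fun_prop
  have hcake := lintegral_comp_eq_lintegral_meas_lt_mul (volume.restrict (ball z₀ r))
    (f := fun x => |w x|) (g := fun t => 2 * c * t * exp (c * t ^ 2))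
    (ae_of_all _ fun x => abs_nonneg _) hw.abs.aemeasurable
    (fun t _ => hcont.intervalIntegrable _ _)
    ((ae_restrict_iff' measurableSet_Ioi).2 (ae_of_all _ fun t ht => by
      have : 0 < t := ht
      show 0 ≤ 2 * c * t * exp (c * t ^ 2)
      positivity))
  have hInt : ∀ x, ∫ t in (0 : ℝ)..|w x|, 2 * c * t * exp (c * t ^ 2) = exp (c * w x ^ 2) - 1 := by
    intro x
    rw [intervalIntegral.integral_eq_sub_of_hasDerivAt (fun t _ => hderiv t)
      (hcont.intervalIntegrable _ _)]
    simp
  simp only [hInt] at hcake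
  rw [hcake]
  calc _ = ∫⁻ t in Ioi (0 : ℝ), ENNReal.ofReal (2 * c * (16 * r ^ 4)) *
      ENNReal.ofReal (t * ψ t) := by
        refine setLIntegral_congr_fun measurableSet_Ioi fun t ht => ?_
        have ht0 : 0 < t := ht
        have hmeas : (volume.restrict (ball z₀ r)) {a | t < |w a|} = volume (E t) := by
          rw [Measure.restrict_apply (measurableSet_lt measurable_const hw.abs.measurable)]
          congr 1; ext x; exact and_comm
        simp only [hmeas]
        rw [← ENNReal.ofReal_toReal (hfin t), ← ENNReal.ofReal_mul ENNReal.toReal_nonneg,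
          ← ENNReal.ofReal_mul (by positivity), hψ]
        congr 1
        simp only
        field_simp
    _ = ENNReal.ofReal (2 * c * (16 * r ^ 4)) * ∫⁻ t in Ioi (0 : ℝ), ENNReal.ofReal (t * ψ t) :=
        lintegral_const_mul' _ _ ENNReal.ofReal_ne_top
    _ ≤ ENNReal.ofReal (2 * c * (16 * r ^ 4)) * ENNReal.ofReal K := by
        gcongr _ * ?_
        exact hKψ ψ hψ0 hmain
    _ = _ := by
        rw [← ENNReal.ofReal_mul (by positivity)]
        congr 1; ring

theorem lintegral_inv_sq_mul_pow_four_le {g : E4 → ENNReal} (hg : Measurable g) (x : E4) {r : ℝ}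
    (hr : 0 < r) :
    (∫⁻ z in ball x r, ENNReal.ofReal ((‖x - z‖ ^ 2)⁻¹) * g z) ^ 4 ≤
      ENNReal.ofReal ((16 * r) ^ 4) * ∫⁻ z in ball x r, g z ^ 4 := by
  have h1 := sq_lintegral_mul_le (μ := volume.restrict (ball x r))
    (f := fun z => ENNReal.ofReal (√((‖x - z‖ ^ 3)⁻¹)))
    (g := fun z => ENNReal.ofReal (√((‖x - z‖ ^ 1)⁻¹)) * g z) (by fun_prop) (by fun_prop)
  have h2 := sq_lintegral_mul_le (μ := volume.restrict (ball x r))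
    (f := fun z => ENNReal.ofReal ((‖x - z‖ ^ 1)⁻¹)) (g := fun z => g z ^ 2) (by fun_prop) (by
        fun_prop)
  have e1 : ∀ z, ENNReal.ofReal (√((‖x - z‖ ^ 3)⁻¹)) * (ENNReal.ofReal (√((‖x - z‖ ^ 1)⁻¹)) * g z) =
      ENNReal.ofReal ((‖x - z‖ ^ 2)⁻¹) * g z := fun z => by
    rw [← mul_assoc, ← ENNReal.ofReal_mul (Real.sqrt_nonneg _), ← Real.sqrt_mul (by positivity)]
    congr 2
    rw [← mul_inv, ← pow_add, Real.sqrt_inv, show 3 + 1 = 2 * 2 by rfl, pow_mul,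
      Real.sqrt_sq (by positivity)]
  have e2 : ∀ (p : ℕ) z, ENNReal.ofReal (√((‖x - z‖ ^ p)⁻¹)) ^ 2 =
      ENNReal.ofReal ((‖x - z‖ ^ p)⁻¹) :=
    fun p z => by rw [← ENNReal.ofReal_pow (Real.sqrt_nonneg _), Real.sq_sqrt (by positivity)]
  have e3 : ∀ z, ENNReal.ofReal ((‖x - z‖ ^ 1)⁻¹) ^ 2 = ENNReal.ofReal ((‖x - z‖ ^ 2)⁻¹) :=
    fun z => by rw [← ENNReal.ofReal_pow (by positivity), pow_one, inv_pow]
  simp only [e1, e2, e3, mul_pow, ← pow_mul] at h1 h2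
  rw [lintegral_ball_inv_pow 3 (by norm_num) x hr.le] at h1
  rw [lintegral_ball_inv_pow 2 (by norm_num) x hr.le] at h2
  norm_num at h1 h2
  calc _ = ((∫⁻ z in ball x r, ENNReal.ofReal ((‖x - z‖ ^ 2)⁻¹) * g z) ^ 2) ^ 2 := by rw [← pow_mul]
    _ ≤ (ENNReal.ofReal (2 * π ^ 2 * r) *
          ∫⁻ z in ball x r, ENNReal.ofReal ((‖x - z‖)⁻¹) * g z ^ 2) ^ 2 := by
        gcongr 1
    _ ≤ ENNReal.ofReal (2 * π ^ 2 * r) ^ 2 * (ENNReal.ofReal (π ^ 2 * r ^ 2) *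
          ∫⁻ z in ball x r, g z ^ 4) := by
        rw [mul_pow]
        gcongr 1
    _ = ENNReal.ofReal (4 * π ^ 6 * r ^ 4) * ∫⁻ z in ball x r, g z ^ 4 := by
        rw [← mul_assoc, ← ENNReal.ofReal_pow (by positivity), ← ENNReal.ofReal_mul (by positivity)]
        congr 2; ring
    _ ≤ _ := by
        gcongr ENNReal.ofReal ?_ * _
        have : π ^ 6 ≤ 4 ^ 6 := by gcongr; exact pi_le_four
        rw [mul_pow]
        gcongr ?_ * _
        linarith

theorem ball_subset_unit_ball {z₀ : E4} (hz : ‖z₀‖ < 1) {ρ : ℝ} (hρ : ρ ≤ (1 - ‖z₀‖ ^ 2) / 2) :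
    ball z₀ ρ ⊆ ball 0 1 := fun x hx => by
  rw [mem_ball, dist_eq_norm] at hx
  rw [mem_ball_zero_iff]
  have h1 : ‖x‖ ≤ ‖z₀‖ + ‖x - z₀‖ := by simpa using norm_add_le z₀ (x - z₀)
  nlinarith [norm_nonneg z₀]

theorem abs_weight_sub_le {x z : E4} (hx : ‖x‖ < 1) (hz : ‖z‖ < 1) :
    |(1 - ‖x‖ ^ 2) - (1 - ‖z‖ ^ 2)| ≤ 2 * ‖x - z‖ := by
  have h := abs_norm_sub_norm_le x z
  rw [show (1 - ‖x‖ ^ 2) - (1 - ‖z‖ ^ 2) = -((‖x‖ - ‖z‖) * (‖x‖ + ‖z‖)) by ring, abs_neg, abs_mul,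
    abs_of_nonneg (by positivity : (0 : ℝ) ≤ ‖x‖ + ‖z‖), mul_comm]
  gcongr
  linarith

theorem weighted_kernel_bound {tx tz a r L y : ℝ} (ha : 0 < a) (har : a ≤ r) (hx0 : 0 < tx)
    (hx : tx ≤ 12 * r) (hz : 4 * r ≤ tz) (hxz : tx ≤ tz + 2 * a) :
    tx * ((4 * π ^ 2 * a ^ 2)⁻¹ * |L| + 12 / (π ^ 2 * r ^ 4) * |tz * y|) ≤
      (4 * π ^ 2)⁻¹ * ((a ^ 2)⁻¹ + (r * a)⁻¹) * |tz * L + y| + 17 / r * ((a ^ 2)⁻¹ * |tz * y|) := by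
  have hr : 0 < r := ha.trans_le har
  have hz0 : 0 < tz := by linarith
  have hL : tz * |L| ≤ |tz * L + y| + |y| := by
    have := abs_sub (tz * L + y) y
    rwa [add_sub_cancel_right, abs_mul, abs_of_pos hz0] at this
  rw [abs_mul tz y, abs_of_pos hz0]
  set f := |tz * L + y|
  have hf : 0 ≤ f := abs_nonneg _
  have hy : 0 ≤ |y| := abs_nonneg _
  have hπ : 9 ≤ π ^ 2 := by nlinarith [pi_gt_three]
  have h1 : tx * |L| ≤ (1 + a / r) * f + 1 / r * (tz * |y|) := by
    have h2 : tx ≤ (1 + a / r) * tz := by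
      have : a / r * (4 * r) ≤ a / r * tz := by gcongr
      have e : a / r * (4 * r) = 4 * a := by field_simp
      linarith
    have h3 : tx ≤ 1 / r * tz * tz := by
      have : 1 / r * (4 * r) * (4 * r) ≤ 1 / r * tz * tz := by gcongr
      have e : 1 / r * (4 * r) * (4 * r) = 16 * r := by field_simp; norm_num
      linarith
    refine le_of_mul_le_mul_left ?_ hz0
    calc tz * (tx * |L|) = tx * (tz * |L|) := by ring
      _ ≤ tx * (f + |y|) := by gcongr
      _ = tx * f + tx * |y| := by ring
      _ ≤ (1 + a / r) * tz * f + 1 / r * tz * tz * |y| := by gcongr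
      _ = _ := by ring
  have h4 : tx * (12 / (π ^ 2 * r ^ 4)) ≤ 16 / r * (a ^ 2)⁻¹ := by
    calc tx * (12 / (π ^ 2 * r ^ 4)) ≤ 12 * r * (12 / (9 * r ^ 4)) := by gcongr
      _ = 16 / r * (r ^ 2)⁻¹ := by field_simp; norm_num
      _ ≤ _ := by gcongr
  have h5 : (4 * π ^ 2 * a ^ 2)⁻¹ ≤ (a ^ 2)⁻¹ := by
    gcongr
    nlinarith [sq_nonneg a]
  calc _ = (4 * π ^ 2 * a ^ 2)⁻¹ * (tx * |L|) + tx * (12 / (π ^ 2 * r ^ 4)) * (tz * |y|) := by ring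
    _ ≤ (4 * π ^ 2 * a ^ 2)⁻¹ * ((1 + a / r) * f + 1 / r * (tz * |y|)) +
        16 / r * (a ^ 2)⁻¹ * (tz * |y|) := by gcongr
    _ = (4 * π ^ 2 * a ^ 2)⁻¹ * (1 + a / r) * f + (4 * π ^ 2 * a ^ 2)⁻¹ * (1 / r * (tz * |y|)) +
        16 / r * (a ^ 2)⁻¹ * (tz * |y|) := by ring
    _ ≤ (4 * π ^ 2 * a ^ 2)⁻¹ * (1 + a / r) * f + (a ^ 2)⁻¹ * (1 / r * (tz * |y|)) +
        16 / r * (a ^ 2)⁻¹ * (tz * |y|) := by gcongr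
    _ = _ := by field_simp; ring

/-- Pointwise bound for `(1 - |x|²) v` by a truncated potential of `(1 - |x|²) Δv +
v / (1 - |x|²)`. -/
theorem enorm_weight_mul_le {v y : E4 → ℝ} (hv : ContDiff ℝ (⊤ : ℕ∞) v)
    (hvy : ∀ x, v x = (1 - ‖x‖ ^ 2) * y x) {z₀ : E4} (hz₀ : ‖z₀‖ < 1) {r M : ℝ}
    (hr : r = (1 - ‖z₀‖ ^ 2) / 8) (hM : 0 ≤ M)
    (hvM : ∫⁻ z in ball z₀ (2 * r), ‖v z‖ₑ ^ 4 ≤ ENNReal.ofReal (M ^ 4)) {x : E4}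
        (hx : x ∈ ball z₀ r) :
    ‖(1 - ‖x‖ ^ 2) * v x‖ₑ ≤ (∫⁻ z, truncKernel r x z * (ball z₀ (2 * r)).indicator
      (fun z => ‖(1 - ‖z‖ ^ 2) * lapE v z + y z‖ₑ) z) + ENNReal.ofReal (272 * M) := by
  have hr0 : 0 < r := by
    rw [hr]; nlinarith [norm_nonneg z₀]
  have hsub : ball z₀ (2 * r) ⊆ ball 0 1 := ball_subset_unit_ball hz₀ (by linarith)
  have hQ : ∀ z ∈ ball z₀ (2 * r), ‖z‖ < 1 ∧ 4 * r ≤ 1 - ‖z‖ ^ 2 ∧ 1 - ‖z‖ ^ 2 ≤ 12 * r := by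
    intro z hz
    have hz1 : ‖z‖ < 1 := mem_ball_zero_iff.1 (hsub hz)
    have h := abs_le.1 (abs_weight_sub_le hz1 hz₀)
    rw [mem_ball, dist_eq_norm] at hz
    exact ⟨hz1, by linarith, by linarith⟩
  have hxQ : x ∈ ball z₀ (2 * r) := ball_subset_ball (by linarith) hx
  obtain ⟨hx1, hx4, hx12⟩ := hQ x hxQ
  have hballx : ball x r ⊆ ball z₀ (2 * r) := fun z hz => by
    rw [mem_ball] at hx hz ⊢
    linarith [dist_triangle z x z₀]
  have hvm : Measurable fun z => ‖v z‖ₑ := hv.continuous.measurable.enorm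
  have hJ : ∫⁻ z in ball x r, ENNReal.ofReal ((‖x - z‖ ^ 2)⁻¹) * ‖v z‖ₑ ≤
      ENNReal.ofReal (16 * r * M) := by
    refine (ENNReal.pow_le_pow_left_iff (n := 4) (by norm_num)).1 ?_
    refine (lintegral_inv_sq_mul_pow_four_le hvm x hr0).trans ?_
    rw [← ENNReal.ofReal_pow (by positivity), mul_pow _ M, ENNReal.ofReal_mul (by positivity)]
    gcongr _ * ?_
    exact (lintegral_mono_set hballx).trans hvM
  have hpt : ∀ᵐ z, z ∈ ball x r →
      ENNReal.ofReal (1 - ‖x‖ ^ 2) * (ENNReal.ofReal ((4 * π ^ 2 * ‖x - z‖ ^ 2)⁻¹) * ‖lapE v z‖ₑ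
        + ENNReal.ofReal (12 / (π ^ 2 * r ^ 4)) * ‖v z‖ₑ) ≤
      truncKernel r x z * (ball z₀ (2 * r)).indicator
        (fun z => ‖(1 - ‖z‖ ^ 2) * lapE v z + y z‖ₑ) z +
      ENNReal.ofReal (17 / r) * (ENNReal.ofReal ((‖x - z‖ ^ 2)⁻¹) * ‖v z‖ₑ) := by
    filter_upwards [(volume : Measure E4).ae_ne x] with z hzx hz
    obtain ⟨hz1, hz4, hz12⟩ := hQ z (hballx hz)
    have hd : ‖x - z‖ < r := by rwa [mem_ball, dist_comm, dist_eq_norm] at hz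
    have hd0 : 0 < ‖x - z‖ := norm_pos_iff.2 (sub_ne_zero.2 hzx.symm)
    have hxz : 1 - ‖x‖ ^ 2 ≤ 1 - ‖z‖ ^ 2 + 2 * ‖x - z‖ := by
      linarith [(abs_le.1 (abs_weight_sub_le hx1 hz1)).2]
    have hker : truncKernel r x z =
        ENNReal.ofReal ((4 * π ^ 2)⁻¹ * ((‖x - z‖ ^ 2)⁻¹ + (r * ‖x - z‖)⁻¹)) :=
      indicator_of_mem (s := Iio r) hd _
    rw [hker, indicator_of_mem (hballx hz)]
    simp only [Real.enorm_eq_ofReal_abs]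
    rw [← ENNReal.ofReal_mul (by positivity), ← ENNReal.ofReal_mul (by positivity),
      ← ENNReal.ofReal_add (by positivity) (by positivity), ← ENNReal.ofReal_mul (by linarith),
      ← ENNReal.ofReal_mul (by positivity), ← ENNReal.ofReal_mul (by positivity),
      ← ENNReal.ofReal_mul (by positivity), ← ENNReal.ofReal_add (by positivity) (by positivity),
          hvy z]
    exact ENNReal.ofReal_le_ofReal
      (weighted_kernel_bound hd0 hd.le (by linarith) hx12 hz4 hxz)
  have hkm : Measurable fun z => ENNReal.ofReal ((‖x - z‖ ^ 2)⁻¹) * ‖v z‖ₑ := by fun_prop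
  calc ‖(1 - ‖x‖ ^ 2) * v x‖ₑ = ENNReal.ofReal (1 - ‖x‖ ^ 2) * ‖v x‖ₑ := by
        rw [enorm_mul, Real.enorm_of_nonneg (by linarith)]
    _ ≤ ENNReal.ofReal (1 - ‖x‖ ^ 2) *
        ((∫⁻ z in ball x r, ENNReal.ofReal ((4 * π ^ 2 * ‖x - z‖ ^ 2)⁻¹) * ‖lapE v z‖ₑ) +
          ENNReal.ofReal (12 / (π ^ 2 * r ^ 4)) * ∫⁻ z in ball x r, ‖v z‖ₑ) := by
        gcongr _ * ?_
        exact enorm_le_potential_add_mean hv x hr0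
    _ = ∫⁻ z in ball x r, ENNReal.ofReal (1 - ‖x‖ ^ 2) *
        (ENNReal.ofReal ((4 * π ^ 2 * ‖x - z‖ ^ 2)⁻¹) * ‖lapE v z‖ₑ
          + ENNReal.ofReal (12 / (π ^ 2 * r ^ 4)) * ‖v z‖ₑ) := by
        rw [lintegral_const_mul' _ _ ENNReal.ofReal_ne_top, lintegral_add_right _ (by fun_prop),
          lintegral_const_mul' _ _ ENNReal.ofReal_ne_top]
    _ ≤ ∫⁻ z in ball x r, (truncKernel r x z * (ball z₀ (2 * r)).indicator
        (fun z => ‖(1 - ‖z‖ ^ 2) * lapE v z + y z‖ₑ) z +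
      ENNReal.ofReal (17 / r) * (ENNReal.ofReal ((‖x - z‖ ^ 2)⁻¹) * ‖v z‖ₑ)) :=
        lintegral_mono_ae ((ae_restrict_iff' measurableSet_ball).2 hpt)
    _ = (∫⁻ z in ball x r, truncKernel r x z * (ball z₀ (2 * r)).indicator
        (fun z => ‖(1 - ‖z‖ ^ 2) * lapE v z + y z‖ₑ) z) +
      ENNReal.ofReal (17 / r) * ∫⁻ z in ball x r, ENNReal.ofReal ((‖x - z‖ ^ 2)⁻¹) * ‖v z‖ₑ := by
        rw [lintegral_add_right _ (hkm.const_mul _), lintegral_const_mul' _ _ ENNReal.ofReal_ne_top]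
    _ ≤ _ := by
        refine add_le_add (setLIntegral_le_lintegral _ _) ?_
        refine (mul_le_mul' le_rfl hJ).trans ?_
        rw [← ENNReal.ofReal_mul (by positivity)]
        refine ENNReal.ofReal_le_ofReal (le_of_eq ?_)
        field_simp
        ring

theorem exp_remainder_scaling {X S : ℝ} (hX : 0 ≤ X) (hS : 0 < S) (hS1 : S ≤ 1) :
    exp X - 1 - X ≤ S ^ 2 * (exp (X / S) - 1) := by
  have hd : ∀ X : ℝ, HasDerivAt (fun X => S ^ 2 * (exp (X / S) - 1 - X / S) - (exp X - 1 - X))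
      (S * (exp (X / S) - 1) - (exp X - 1)) X := by
    intro X
    have h1 := (hasDerivAt_id X).div_const S
    have h2 := ((((h1.exp.sub_const 1).sub h1).const_mul (S ^ 2)).sub
      (((Real.hasDerivAt_exp X).sub_const 1).sub (hasDerivAt_id X)))
    refine HasDerivAt.congr_deriv h2 ?_
    simp only [id]
    field_simp
  have hmono : MonotoneOn (fun X => S ^ 2 * (exp (X / S) - 1 - X / S) - (exp X - 1 - X))
      (Ici 0) := by
    refine monotoneOn_of_deriv_nonneg (convex_Ici 0) (fun X _ =>
        (hd X).continuousAt.continuousWithinAt)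
      (fun X _ => (hd X).differentiableAt.differentiableWithinAt) fun X _ => ?_
    rw [(hd X).deriv]
    have := convexOn_exp.2 (mem_univ (X / S)) (mem_univ 0) hS.le (sub_nonneg.2 hS1) (by ring)
    simp only [smul_eq_mul, mul_zero, add_zero, exp_zero, mul_div_cancel₀ X hS.ne'] at this
    linarith
  have h0 := hmono (mem_Ici.2 le_rfl) (mem_Ici.2 hX) hX
  simp only [zero_div, exp_zero, sub_self, mul_zero] at h0
  have : 0 ≤ S ^ 2 * (X / S) := by positivity
  linarith

theorem exists_local_exp_le {κ : ℝ} (hκ : 0 < κ) :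
    ∃ K : ℝ, 0 < K ∧ ∀ v y : E4 → ℝ, ContDiff ℝ (⊤ : ℕ∞) v → Continuous y →
      (∀ x, v x = (1 - ‖x‖ ^ 2) * y x) → ∀ z₀ : E4, ‖z₀‖ < 1 → ∀ m M S : ℝ, 0 ≤ m → 0 ≤ M →
      0 < S → S ≤ 1 → m + κ * M ^ 2 ≤ S →
      ∫⁻ z in ball z₀ ((1 - ‖z₀‖ ^ 2) / 4), ‖(1 - ‖z‖ ^ 2) * lapE v z + y z‖ₑ ^ 2 ≤
          ENNReal.ofReal m →
      ∫⁻ z in ball z₀ ((1 - ‖z₀‖ ^ 2) / 4), ‖v z‖ₑ ^ 4 ≤ ENNReal.ofReal (M ^ 4) →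
      ∫⁻ x in ball z₀ ((1 - ‖z₀‖ ^ 2) / 8),
          ENNReal.ofReal (exp (32 * π ^ 2 * ((1 - ‖x‖ ^ 2) * v x) ^ 2) - 1
            - 32 * π ^ 2 * ((1 - ‖x‖ ^ 2) * v x) ^ 2) ≤
        ENNReal.ofReal (S ^ 2 * K * (1 - ‖z₀‖ ^ 2) ^ 4) := by
  obtain ⟨K, hK, h⟩ := exists_lintegral_exp_le (κ := κ / 272 ^ 2) (by positivity)
  refine ⟨K, hK, fun v y hv hy hvy z₀ hz₀ m M S hm hM hS hS1 hmS hf hvM => ?_⟩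
  set r := (1 - ‖z₀‖ ^ 2) / 8 with hr
  have hr0 : 0 < r := by
    rw [hr]; nlinarith [norm_nonneg z₀]
  have hr2 : (1 - ‖z₀‖ ^ 2) / 4 = 2 * r := by rw [hr]; ring
  rw [hr2] at hf hvM
  set F : E4 → ENNReal := (ball z₀ (2 * r)).indicator
    (fun z => ‖(1 - ‖z‖ ^ 2) * lapE v z + y z‖ₑ) with hF
  have hlap : Continuous (lapE v) := (contDiff_lapE hv).continuous
  have hFm : Measurable F := by
    refine Measurable.indicator ?_ measurableSet_ball
    have : Continuous fun z => (1 - ‖z‖ ^ 2) * lapE v z + y z := by fun_prop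
    exact this.measurable.enorm
  have hsq : 0 < √S := Real.sqrt_pos.2 hS
  have hcont : Continuous fun x => (√S)⁻¹ * ((1 - ‖x‖ ^ 2) * v x) := by
    have := hv.continuous
    fun_prop
  have hmain := h r ((√S)⁻¹ * (272 * M)) (S⁻¹ * m) z₀ (fun x => (√S)⁻¹ * ((1 - ‖x‖ ^ 2) * v x))
    (fun z => ENNReal.ofReal (√S)⁻¹ * F z) hr0 hcont (hFm.const_mul _) (by positivity) (by
        positivity)
    (fun x hx => by
      rw [enorm_mul, Real.enorm_of_nonneg (by positivity), ENNReal.ofReal_mul (by positivity)]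
      refine (mul_le_mul' le_rfl (enorm_weight_mul_le hv hvy hz₀ hr hM hvM hx)).trans (le_of_eq ?_)
      rw [mul_add, ← lintegral_const_mul' _ _ ENNReal.ofReal_ne_top]
      congr 1
      exact lintegral_congr fun z => mul_left_comm _ _ _)
    (by
      simp only [mul_pow]
      rw [lintegral_const_mul' _ _ (by simp), ← ENNReal.ofReal_pow (by positivity), inv_pow,
        Real.sq_sqrt hS.le, ENNReal.ofReal_mul (by positivity)]
      gcongr _ * ?_
      refine le_trans (le_of_eq ?_) hf
      rw [← lintegral_indicator measurableSet_ball]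
      refine lintegral_congr fun z => ?_
      by_cases hz : z ∈ ball z₀ (2 * r) <;> simp [hF, hz])
    (by
      rw [mul_pow, inv_pow, Real.sq_sqrt hS.le]
      calc _ = S⁻¹ * (m + κ * M ^ 2) := by ring
        _ ≤ S⁻¹ * S := by gcongr
        _ = 1 := inv_mul_cancel₀ hS.ne')
  calc _ ≤ ∫⁻ x in ball z₀ r, ENNReal.ofReal (S ^ 2) *
        ENNReal.ofReal (exp (32 * π ^ 2 * ((√S)⁻¹ * ((1 - ‖x‖ ^ 2) * v x)) ^ 2) - 1) := by
        refine lintegral_mono fun x => ?_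
        rw [← ENNReal.ofReal_mul (by positivity)]
        refine ENNReal.ofReal_le_ofReal ?_
        refine (exp_remainder_scaling (by positivity) hS hS1).trans (le_of_eq ?_)
        rw [mul_pow (√S)⁻¹, inv_pow, Real.sq_sqrt hS.le]
        congr 3
        field_simp
    _ ≤ ENNReal.ofReal (S ^ 2) * ENNReal.ofReal (K * r ^ 4) := by
        rw [lintegral_const_mul' _ _ ENNReal.ofReal_ne_top]
        gcongr _ * ?_
    _ ≤ _ := by
        rw [← ENNReal.ofReal_mul (by positivity), mul_assoc]
        refine ENNReal.ofReal_le_ofReal ?_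
        have : r ≤ 1 - ‖z₀‖ ^ 2 := by linarith
        gcongr

/-- Local estimates on hyperbolic balls sum up to a weighted global estimate. -/
theorem lintegral_weighted_le_of_local {Φ H : E4 → ENNReal} (hΦ : Measurable Φ) (hH : Measurable H)
    (hloc : ∀ z : E4, ‖z‖ < 1 → ∫⁻ x in ball z ((1 - ‖z‖ ^ 2) / 8), Φ x ≤
      ENNReal.ofReal ((1 - ‖z‖ ^ 2) ^ 4) * ∫⁻ x in ball z ((1 - ‖z‖ ^ 2) / 4), H x) :
    ∫⁻ x in ball 0 1, Φ x * ENNReal.ofReal (((1 - ‖x‖ ^ 2) ^ 4)⁻¹) ≤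
      ENNReal.ofReal 20000 * ∫⁻ x in ball 0 1, H x := by
  set A : ℝ → Set (E4 × E4) := fun a => {p | ‖p.1 - p.2‖ < (1 - ‖p.2‖ ^ 2) / a} with hA
  have hAm : ∀ a, MeasurableSet (A a) := fun a => measurableSet_lt (by fun_prop) (by fun_prop)
  set T : E4 → ENNReal := fun z => ENNReal.ofReal (((1 - ‖z‖ ^ 2) ^ 4)⁻¹) with hT
  have hTm : Measurable T := by fun_prop
  have hslice : ∀ a (g : E4 → ENNReal) z, ∫⁻ x, (A a).indicator (fun p => g p.1) (x, z) =
      ∫⁻ x in ball z ((1 - ‖z‖ ^ 2) / a), g x := by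
    intro a g z
    rw [← lintegral_indicator measurableSet_ball]
    refine lintegral_congr fun x => ?_
    simp only [indicator, hA, mem_ball, dist_eq_norm]
    rfl
  have hlow : ∀ x : E4, ‖x‖ < 1 → T x ≤ ENNReal.ofReal 10000 *
      ∫⁻ z in ball 0 1, (A 8).indicator (fun p => T p.2 ^ 2) (x, z) := by
    intro x hx
    have ht : 0 < 1 - ‖x‖ ^ 2 := by nlinarith [norm_nonneg x]
    set t := 1 - ‖x‖ ^ 2 with htx
    have hsub : ball x (t / 10) ⊆ ball 0 1 := ball_subset_unit_ball hx (by linarith)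
    have hz : ∀ z ∈ ball x (t / 10), ENNReal.ofReal ((((6 / 5 * t) ^ 4)⁻¹) ^ 2) ≤
        (A 8).indicator (fun p => T p.2 ^ 2) (x, z) := by
      intro z hz
      have hz1 := mem_ball_zero_iff.1 (hsub hz)
      have h := abs_le.1 (abs_weight_sub_le hz1 hx)
      rw [mem_ball, dist_eq_norm] at hz
      have hmem : (x, z) ∈ A 8 := by
        show ‖x - z‖ < _ / 8
        rw [norm_sub_rev]; linarith
      rw [indicator_of_mem hmem]
      show _ ≤ T z ^ 2
      have hz0 : 0 < 1 - ‖z‖ ^ 2 := by linarith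
      rw [hT, ← ENNReal.ofReal_pow (by positivity)]
      refine ENNReal.ofReal_le_ofReal ?_
      gcongr
      linarith
    calc T x ≤ ENNReal.ofReal 10000 * (ENNReal.ofReal ((((6 / 5 * t) ^ 4)⁻¹) ^ 2) *
          ENNReal.ofReal (π ^ 2 / 2 * (t / 10) ^ 4)) := by
          rw [← ENNReal.ofReal_mul (by positivity), ← ENNReal.ofReal_mul (by positivity)]
          refine ENNReal.ofReal_le_ofReal ?_
          have hπ : 9 ≤ π ^ 2 := by nlinarith [pi_gt_three]
          calc (t ^ 4)⁻¹ ≤ 9 / 2 / (6 / 5) ^ 8 * (t ^ 4)⁻¹ := by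
                refine le_mul_of_one_le_left (by positivity) ?_
                norm_num
            _ ≤ π ^ 2 / 2 / (6 / 5) ^ 8 * (t ^ 4)⁻¹ := by gcongr
            _ = _ := by field_simp; norm_num
      _ = ENNReal.ofReal 10000 * ∫⁻ z in ball x (t / 10),
          ENNReal.ofReal ((((6 / 5 * t) ^ 4)⁻¹) ^ 2) := by
          rw [lintegral_const, Measure.restrict_apply_univ, volume_ball_E4 x (by positivity)]
      _ ≤ ENNReal.ofReal 10000 * ∫⁻ z in ball x (t / 10),
          (A 8).indicator (fun p => T p.2 ^ 2) (x, z) := by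
          gcongr _ * ?_
          exact setLIntegral_mono' measurableSet_ball hz
      _ ≤ _ := by
          gcongr _ * ?_
          exact lintegral_mono_set hsub
  have hup : ∀ x : E4, ‖x‖ < 1 →
      ∫⁻ z in ball 0 1, (A 4).indicator (fun p => T p.2) (x, z) ≤ ENNReal.ofReal 2 := by
    intro x hx
    have ht : 0 < 1 - ‖x‖ ^ 2 := by nlinarith [norm_nonneg x]
    set t := 1 - ‖x‖ ^ 2 with htx
    calc _ ≤ ∫⁻ z in ball 0 1, (ball x (t / 2)).indicator
          (fun _ => ENNReal.ofReal (((2 / 3 * t) ^ 4)⁻¹)) z := by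
          refine setLIntegral_mono' measurableSet_ball fun z hz => ?_
          have hz1 := mem_ball_zero_iff.1 hz
          by_cases hmem : (x, z) ∈ A 4
          · have hm : ‖x - z‖ < (1 - ‖z‖ ^ 2) / 4 := hmem
            have h := abs_le.1 (abs_weight_sub_le hx hz1)
            have hb : z ∈ ball x (t / 2) := by
              rw [mem_ball, dist_comm, dist_eq_norm]; linarith
            rw [indicator_of_mem hmem, indicator_of_mem hb]
            refine ENNReal.ofReal_le_ofReal ?_
            gcongr
            linarith
          · rw [indicator_of_notMem hmem]
            exact zero_le
      _ ≤ ∫⁻ z, (ball x (t / 2)).indicator (fun _ => ENNReal.ofReal (((2 / 3 * t) ^ 4)⁻¹)) z :=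
          setLIntegral_le_lintegral _ _
      _ = ENNReal.ofReal (((2 / 3 * t) ^ 4)⁻¹ * (π ^ 2 / 2 * (t / 2) ^ 4)) := by
          rw [lintegral_indicator measurableSet_ball, lintegral_const, Measure.restrict_apply_univ,
            volume_ball_E4 x (by positivity), ← ENNReal.ofReal_mul (by positivity)]
      _ ≤ _ := by
          refine ENNReal.ofReal_le_ofReal ?_
          have hπ : π ^ 2 ≤ 10 := by nlinarith [pi_lt_d2, pi_pos]
          calc _ = (3 / 2) ^ 4 / 32 * π ^ 2 := by field_simp; norm_num
            _ ≤ (3 / 2) ^ 4 / 32 * 10 := by gcongr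
            _ ≤ 2 := by norm_num
  have hT0 : ∀ z : E4, ‖z‖ < 1 → T z * ENNReal.ofReal ((1 - ‖z‖ ^ 2) ^ 4) = 1 := fun z hz => by
    have : 0 < 1 - ‖z‖ ^ 2 := by nlinarith [norm_nonneg z]
    rw [hT, ← ENNReal.ofReal_mul (by positivity), inv_mul_cancel₀ (by positivity),
        ENNReal.ofReal_one]
  have hind : ∀ a (f g : E4 → ENNReal), Measurable f → Measurable g →
      Measurable fun p : E4 × E4 => f p.1 * (A a).indicator (fun p => g p.2) p := fun a f g hf hg =>
    (hf.comp measurable_fst).mul ((hg.comp measurable_snd).indicator (hAm a))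
  have hfub : ∀ a (f g : E4 → ENNReal), Measurable f → Measurable g →
      ∫⁻ x in ball 0 1, f x * ∫⁻ z in ball 0 1, (A a).indicator (fun p => g p.2) (x, z) =
      ∫⁻ z in ball 0 1, g z * ∫⁻ x in ball 0 1, (A a).indicator (fun p => f p.1) (x, z) := by
    intro a f g hf hg
    have hs1 : ∀ x, Measurable fun z => (A a).indicator (fun p => g p.2) (x, z) := fun x =>
      ((hg.comp measurable_snd).indicator (hAm a)).comp measurable_prodMk_left
    have hs2 : ∀ z, Measurable fun x => (A a).indicator (fun p => f p.1) (x, z) := fun z =>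
      ((hf.comp measurable_fst).indicator (hAm a)).comp measurable_prodMk_right
    simp only [← lintegral_const_mul _ (hs1 _), ← lintegral_const_mul _ (hs2 _)]
    rw [lintegral_lintegral_swap (hind a f g hf hg).aemeasurable]
    refine lintegral_congr fun z => lintegral_congr fun x => ?_
    by_cases hm : (x, z) ∈ A a
    · simp only [indicator_of_mem hm, mul_comm]
    · simp only [indicator_of_notMem hm, mul_zero]
  calc ∫⁻ x in ball 0 1, Φ x * T x
      ≤ ∫⁻ x in ball 0 1, ENNReal.ofReal 10000 *
          (Φ x * ∫⁻ z in ball 0 1, (A 8).indicator (fun p => T p.2 ^ 2) (x, z)) := by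
        refine setLIntegral_mono' measurableSet_ball fun x hx => ?_
        rw [mul_left_comm]
        gcongr _ * ?_
        exact hlow x (mem_ball_zero_iff.1 hx)
    _ = ENNReal.ofReal 10000 * ∫⁻ z in ball 0 1, T z ^ 2 *
          ∫⁻ x in ball 0 1, (A 8).indicator (fun p => Φ p.1) (x, z) := by
        rw [lintegral_const_mul' _ _ ENNReal.ofReal_ne_top, hfub 8 Φ _ hΦ (hTm.pow_const 2)]
    _ ≤ ENNReal.ofReal 10000 * ∫⁻ z in ball 0 1, T z *
          ∫⁻ x in ball 0 1, (A 4).indicator (fun p => H p.1) (x, z) := by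
        gcongr _ * ?_
        refine setLIntegral_mono' measurableSet_ball fun z hz => ?_
        have hz1 := mem_ball_zero_iff.1 hz
        have ht : 0 < 1 - ‖z‖ ^ 2 := by nlinarith [norm_nonneg z]
        have hsub : ball z ((1 - ‖z‖ ^ 2) / 4) ⊆ ball 0 1 := ball_subset_unit_ball hz1 (by linarith)
        have hH4 : ∫⁻ x in ball 0 1, (A 4).indicator (fun p => H p.1) (x, z) =
            ∫⁻ x in ball z ((1 - ‖z‖ ^ 2) / 4), H x := by
          rw [← hslice 4 H z, ← lintegral_indicator measurableSet_ball]
          refine lintegral_congr fun x => ?_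
          by_cases hx : x ∈ ball (0 : E4) 1
          · rw [indicator_of_mem hx]
          · have : (x, z) ∉ A 4 := fun h => hx (hsub (by
              rw [mem_ball, dist_eq_norm]; exact h))
            rw [indicator_of_notMem hx, indicator_of_notMem this]
        calc _ ≤ T z ^ 2 * ∫⁻ x in ball z ((1 - ‖z‖ ^ 2) / 8), Φ x := by
              rw [← hslice 8 Φ z]
              gcongr _ * ?_
              exact setLIntegral_le_lintegral _ _
          _ ≤ T z ^ 2 * (ENNReal.ofReal ((1 - ‖z‖ ^ 2) ^ 4) *
                ∫⁻ x in ball z ((1 - ‖z‖ ^ 2) / 4), H x) := by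
              gcongr _ * ?_
              exact hloc z hz1
          _ = T z * (T z * ENNReal.ofReal ((1 - ‖z‖ ^ 2) ^ 4)) *
                ∫⁻ x in ball z ((1 - ‖z‖ ^ 2) / 4), H x := by ring
          _ = _ := by rw [hT0 z hz1, mul_one, hH4]
    _ = ENNReal.ofReal 10000 * ∫⁻ x in ball 0 1, H x *
          ∫⁻ z in ball 0 1, (A 4).indicator (fun p => T p.2) (x, z) := by
        rw [hfub 4 H T hH hTm]
    _ ≤ ENNReal.ofReal 10000 * ∫⁻ x in ball 0 1, H x * ENNReal.ofReal 2 := by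
        gcongr _ * ?_
        refine setLIntegral_mono' measurableSet_ball fun x hx => ?_
        gcongr _ * ?_
        exact hup x (mem_ball_zero_iff.1 hx)
    _ = _ := by
        rw [lintegral_mul_const' _ _ ENNReal.ofReal_ne_top, mul_comm (∫⁻ x in ball 0 1, H x),
            ← mul_assoc,
          ← ENNReal.ofReal_mul (by norm_num)]
        norm_num

theorem contDiff_div_weight {g : E4 → ℝ} (hg : ContDiff ℝ (⊤ : ℕ∞) g) (hs : tsupport g ⊆ ball 0 1) :
    ContDiff ℝ (⊤ : ℕ∞) fun x => g x / (1 - ‖x‖ ^ 2) := by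
  refine contDiff_iff_contDiffAt.2 fun x => ?_
  by_cases hx : x ∈ tsupport g
  · have : ‖x‖ < 1 := mem_ball_zero_iff.1 (hs hx)
    exact hg.contDiffAt.div (contDiff_const.sub (contDiff_norm_sq ℝ)).contDiffAt
      (by nlinarith [norm_nonneg x])
  · refine (contDiffAt_const (c := (0 : ℝ))).congr_of_eventuallyEq ?_
    filter_upwards [notMem_tsupport_iff_eventuallyEq.1 hx] with z hz
    simp [hz]

theorem tsupport_div_subset {g : E4 → ℝ} (k : E4 → ℝ) :
    tsupport (fun x => g x / k x) ⊆ tsupport g :=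
  closure_mono fun x hx => by
    simp only [Function.mem_support] at hx ⊢
    exact fun h => hx (by simp [h])

theorem eq_zero_of_one_le_norm {g : E4 → ℝ} (hs : tsupport g ⊆ ball 0 1) {x : E4} (hx : 1 ≤ ‖x‖) :
    g x = 0 :=
  image_eq_zero_of_notMem_tsupport fun h => absurd (mem_ball_zero_iff.1 (hs h)) hx.not_gt

theorem setLIntegral_enorm_pow {g : E4 → ℝ} (hg : Continuous g) (hc : HasCompactSupport g) {n : ℕ}
    (hn : Even n) (hn0 : n ≠ 0) (s : Set E4) :
    ∫⁻ x in s, ‖g x‖ₑ ^ n = ENNReal.ofReal (∫ x in s, g x ^ n) := by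
  have hi : Integrable fun x => g x ^ n :=
    integrable_of_cont (hg.pow n) (hc.comp_left (g := fun s : ℝ => s ^ n) (by simp [hn0]))
  rw [ofReal_integral_eq_lintegral_ofReal hi.integrableOn (ae_of_all _ fun x => hn.pow_nonneg _)]
  refine lintegral_congr fun x => ?_
  rw [Real.enorm_eq_ofReal_abs, ← ENNReal.ofReal_pow (abs_nonneg _), hn.pow_abs]

/-- The exponential estimate near `z₀`, with the local energy of `v` on the right-hand side. -/
theorem exists_setLIntegral_exp_le {κ : ℝ} (hκ : 0 < κ) :
    ∃ K : ℝ, 0 < K ∧ ∀ v y : E4 → ℝ, ContDiff ℝ (⊤ : ℕ∞) v → HasCompactSupport v →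
      Continuous y → HasCompactSupport y → (∀ x, v x = (1 - ‖x‖ ^ 2) * y x) →
      (∫ x, ((1 - ‖x‖ ^ 2) * lapE v x + y x) ^ 2) + κ * √(∫ x, v x ^ 4) ≤ 1 →
      ∀ z₀ : E4, ‖z₀‖ < 1 →
      ∫⁻ x in ball z₀ ((1 - ‖z₀‖ ^ 2) / 8),
          ENNReal.ofReal (exp (32 * π ^ 2 * ((1 - ‖x‖ ^ 2) * v x) ^ 2) - 1
            - 32 * π ^ 2 * ((1 - ‖x‖ ^ 2) * v x) ^ 2) ≤
        ENNReal.ofReal ((1 - ‖z₀‖ ^ 2) ^ 4) * ∫⁻ x in ball z₀ ((1 - ‖z₀‖ ^ 2) / 4),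
          ENNReal.ofReal (K * (((1 - ‖x‖ ^ 2) * lapE v x + y x) ^ 2 + κ ^ 2 * v x ^ 4)) := by
  obtain ⟨K, hK, h⟩ := exists_local_exp_le hκ
  refine ⟨2 * K, by positivity, fun v y hv hvc hy hyc hvy hE z₀ hz₀ => ?_⟩
  set f : E4 → ℝ := fun x => (1 - ‖x‖ ^ 2) * lapE v x + y x with hf
  have hfC : Continuous f := by
    have := (contDiff_lapE hv).continuous
    fun_prop
  have hfc : HasCompactSupport f := (hasCompactSupport_lapE hvc).mul_left.add hyc
  have hf2 : Integrable fun x => f x ^ 2 := integrable_of_cont (hfC.pow 2)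
      (hasCompactSupport_sq hfc)
  have hv4 : Integrable fun x => v x ^ 4 := integrable_of_cont (hv.continuous.pow 4)
    (hvc.comp_left (g := fun s : ℝ => s ^ 4) (by simp))
  set Q := ball z₀ ((1 - ‖z₀‖ ^ 2) / 4) with hQ
  set m := ∫ x in Q, f x ^ 2 with hm
  set W := ∫ x in Q, v x ^ 4 with hW
  have hm0 : 0 ≤ m := integral_nonneg fun x => by positivity
  have hW0 : 0 ≤ W := integral_nonneg fun x => by positivity
  have hm1 : m ≤ ∫ x, f x ^ 2 := setIntegral_le_integral hf2 (ae_of_all _ fun x => by positivity)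
  have hW1 : W ≤ ∫ x, v x ^ 4 := setIntegral_le_integral hv4 (ae_of_all _ fun x => by positivity)
  have hS1 : m + κ * √W ≤ 1 := by
    refine le_trans ?_ hE
    gcongr
  have hsW : 0 ≤ √W := Real.sqrt_nonneg _
  have hM : (√√W) ^ 2 = √W := Real.sq_sqrt hsW
  have hM4 : (√√W) ^ 4 = W := by
    rw [show (4 : ℕ) = 2 * 2 by rfl, pow_mul, hM, Real.sq_sqrt hW0]
  have hfm : ∫⁻ x in Q, ‖f x‖ₑ ^ 2 ≤ ENNReal.ofReal m :=
    (setLIntegral_enorm_pow hfC hfc even_two two_ne_zero Q).le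
  have hvm : ∫⁻ x in Q, ‖v x‖ₑ ^ 4 ≤ ENNReal.ofReal ((√√W) ^ 4) := by
    rw [hM4]
    exact (setLIntegral_enorm_pow hv.continuous hvc (by decide) four_ne_zero Q).le
  have hloc : ∀ S : ℝ, 0 < S → S ≤ 1 → m + κ * √W ≤ S →
      ∫⁻ x in ball z₀ ((1 - ‖z₀‖ ^ 2) / 8),
          ENNReal.ofReal (exp (32 * π ^ 2 * ((1 - ‖x‖ ^ 2) * v x) ^ 2) - 1
            - 32 * π ^ 2 * ((1 - ‖x‖ ^ 2) * v x) ^ 2) ≤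
        ENNReal.ofReal (S ^ 2 * K * (1 - ‖z₀‖ ^ 2) ^ 4) := by
    intro S hS hS1 hle
    exact h v y hv hy hvy z₀ hz₀ m (√√W) S hm0 (Real.sqrt_nonneg _) hS hS1 (by rwa [hM]) hfm hvm
  have ht : 0 < 1 - ‖z₀‖ ^ 2 := by nlinarith [norm_nonneg z₀]
  rcases (add_nonneg hm0 (mul_nonneg hκ.le hsW)).lt_or_eq with hS | hS
  · refine (hloc _ hS hS1 le_rfl).trans ?_
    have hv4' : Integrable fun x => κ ^ 2 * v x ^ 4 := hv4.const_mul _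
    have hi : Integrable fun x => 2 * K * (f x ^ 2 + κ ^ 2 * v x ^ 4) := (hf2.add hv4').const_mul _
    rw [← ofReal_integral_eq_lintegral_ofReal hi.integrableOn (ae_of_all _ fun x => by positivity),
      ← ENNReal.ofReal_mul (by positivity)]
    refine ENNReal.ofReal_le_ofReal ?_
    rw [integral_const_mul, integral_add hf2.integrableOn hv4'.integrableOn,
      integral_const_mul, ← hm, ← hW, mul_comm]
    gcongr ((1 - ‖z₀‖ ^ 2) ^ 4) * ?_
    have hm2 : m ≤ 1 := by
      have : 0 ≤ κ * √W := by positivity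
      linarith
    have h1 : (m + κ * √W) ^ 2 ≤ 2 * (m + κ ^ 2 * W) := by
      have h2 : (κ * √W) ^ 2 = κ ^ 2 * W := by rw [mul_pow, Real.sq_sqrt hW0]
      nlinarith [sq_nonneg (m - κ * √W)]
    nlinarith [mul_le_mul_of_nonneg_right h1 hK.le]
  · refine le_trans (ge_of_tendsto (x := nhdsWithin (0 : ℝ) (Ioi 0))
      (f := fun S : ℝ => ENNReal.ofReal (S ^ 2 * K * (1 - ‖z₀‖ ^ 2) ^ 4)) (a := 0) ?_ ?_) zero_le
    · have : Continuous fun S : ℝ => ENNReal.ofReal (S ^ 2 * K * (1 - ‖z₀‖ ^ 2) ^ 4) :=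
        ENNReal.continuous_ofReal.comp (by fun_prop)
      have h2 := this.tendsto 0
      simp only [ne_eq, OfNat.ofNat_ne_zero, not_false_eq_true, zero_pow, zero_mul,
        ENNReal.ofReal_zero] at h2
      exact h2.mono_left nhdsWithin_le_nhds
    · filter_upwards [Ioc_mem_nhdsGT (zero_lt_one' ℝ)] with S hS'
      exact hloc S hS'.1 hS'.2 (hS.symm.le.trans hS'.1.le)

theorem hardy_adams_bilaplacian :
    ∃ C : ℝ, 0 < C ∧ ∀ u : E4 → ℝ, ContDiff ℝ (⊤ : ℕ∞) u → HasCompactSupport u →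
      tsupport u ⊆ Metric.ball (0 : E4) 1 →
      (∫ x in Metric.ball (0 : E4) 1, |lapE u x| ^ 2)
        - 9 * (∫ x in Metric.ball (0 : E4) 1, u x ^ 2 / (1 - ‖x‖ ^ 2) ^ 4) ≤ 1 →
      16 * (∫ x in Metric.ball (0 : E4) 1,
          (Real.exp (32 * π ^ 2 * u x ^ 2) - 1 - 32 * π ^ 2 * u x ^ 2)
            / (1 - ‖x‖ ^ 2) ^ 4) ≤ C := by
  obtain ⟨K, hK, hMaz⟩ := hardy_sobolev_mazya
  obtain ⟨L, hL, hloc⟩ := exists_setLIntegral_exp_le (κ := 10 / K) (by positivity)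
  refine ⟨16 * (40000 * L), by positivity, fun u hu huc hus hE => ?_⟩
  set v : E4 → ℝ := fun x => u x / (1 - ‖x‖ ^ 2) with hv
  set y : E4 → ℝ := fun x => v x / (1 - ‖x‖ ^ 2) with hy
  have hvC : ContDiff ℝ (⊤ : ℕ∞) v := contDiff_div_weight hu hus
  have hvu : tsupport v ⊆ tsupport u := tsupport_div_subset _
  have hyv : tsupport y ⊆ tsupport v := tsupport_div_subset _
  have hvs : tsupport v ⊆ ball 0 1 := hvu.trans hus
  have hyC : ContDiff ℝ (⊤ : ℕ∞) y := contDiff_div_weight hvC hvs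
  have hvc : HasCompactSupport v := huc.mono' (subset_tsupport v |>.trans hvu)
  have hyc : HasCompactSupport y := hvc.mono' (subset_tsupport y |>.trans hyv)
  have hmul : ∀ g : E4 → ℝ, tsupport g ⊆ ball 0 1 → ∀ x,
      g x = (1 - ‖x‖ ^ 2) * (g x / (1 - ‖x‖ ^ 2)) := by
    intro g hg x
    by_cases hx : 1 - ‖x‖ ^ 2 = 0
    · have : 1 ≤ ‖x‖ := by nlinarith [norm_nonneg x]
      rw [hx, zero_mul, eq_zero_of_one_le_norm hg this]
    · rw [mul_div_cancel₀ _ hx]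
  have huv : ∀ x, u x = (1 - ‖x‖ ^ 2) * v x := hmul u hus
  have hvy : ∀ x, v x = (1 - ‖x‖ ^ 2) * y x := hmul v hvs
  have hy0 : ∀ x : E4, 1 ≤ ‖x‖ → y x = 0 := fun x => eq_zero_of_one_le_norm (hyv.trans hvs)
  obtain ⟨hD, hv4⟩ := hMaz v y hvC hyC hvc hyc hvy hy0
  set D := ∫ x, (gradSq v x - y x ^ 2) with hDdef
  have hout : ∀ x, x ∉ ball (0 : E4) 1 → 1 ≤ ‖x‖ := fun x hx => by
    rwa [mem_ball_zero_iff, not_lt] at hx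
  have hlap : ∫ x in ball (0 : E4) 1, |lapE u x| ^ 2 = ∫ x, lapE u x ^ 2 := by
    simp only [sq_abs]
    refine setIntegral_eq_integral_of_forall_compl_eq_zero fun x hx => ?_
    rw [lapE_eq_zero_of_notMem_tsupport fun h => hx (hus h), zero_pow two_ne_zero]
  have hhardy : ∫ x in ball (0 : E4) 1, u x ^ 2 / (1 - ‖x‖ ^ 2) ^ 4 = ∫ x, y x ^ 2 := by
    have : ∀ x, u x ^ 2 / (1 - ‖x‖ ^ 2) ^ 4 = y x ^ 2 := fun x => by
      rw [hy, hv]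
      simp only [div_pow, div_div]
      ring
    simp only [this]
    refine setIntegral_eq_integral_of_forall_compl_eq_zero fun x hx => ?_
    rw [hy0 x (hout x hx), zero_pow two_ne_zero]
  rw [hlap, hhardy, energy_identity hvC hvc hyC.continuous hyc huv hvy, ← hDdef] at hE
  set f : E4 → ℝ := fun x => (1 - ‖x‖ ^ 2) * lapE v x + y x with hf
  have hfC : Continuous f := by
    have := (contDiff_lapE hvC).continuous
    have := hyC.continuous
    fun_prop
  have hfc : HasCompactSupport f := (hasCompactSupport_lapE hvc).mul_left.add hyc
  have hf2 : Integrable fun x => f x ^ 2 := integrable_of_cont (hfC.pow 2)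
      (hasCompactSupport_sq hfc)
  have hv4i : Integrable fun x => v x ^ 4 := integrable_of_cont (hvC.continuous.pow 4)
    (hvc.comp_left (g := fun s : ℝ => s ^ 4) (by simp))
  have hf0 : 0 ≤ ∫ x, f x ^ 2 := integral_nonneg fun x => by positivity
  have henergy : (∫ x, f x ^ 2) + 10 / K * √(∫ x, v x ^ 4) ≤ 1 := by
    have h1 : √(∫ x, v x ^ 4) ≤ K * D := Real.sqrt_le_iff.2 ⟨by positivity, hv4⟩
    have h2 : 10 / K * √(∫ x, v x ^ 4) ≤ 10 / K * (K * D) := by gcongr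
    have h3 : 10 / K * (K * D) = 10 * D := by field_simp
    linarith
  have hcover := lintegral_weighted_le_of_local
    (Φ := fun x => ENNReal.ofReal (exp (32 * π ^ 2 * u x ^ 2) - 1 - 32 * π ^ 2 * u x ^ 2))
    (H := fun x => ENNReal.ofReal (L * (f x ^ 2 + (10 / K) ^ 2 * v x ^ 4)))
    (by have := hu.continuous.measurable; fun_prop)
    (by have := hfC.measurable; have := hvC.continuous.measurable; fun_prop)
    (fun z hz => by
      simp only [huv]
      exact hloc v y hvC hvc hyC.continuous hyc hvy henergy z hz)
  have hH : ∫⁻ x in ball (0 : E4) 1, ENNReal.ofReal (L * (f x ^ 2 + (10 / K) ^ 2 * v x ^ 4)) ≤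
      ENNReal.ofReal (L * 2) := by
    refine (setLIntegral_le_lintegral _ _).trans ?_
    have hv4' : Integrable fun x => (10 / K) ^ 2 * v x ^ 4 := hv4i.const_mul _
    have hi : Integrable fun x => L * (f x ^ 2 + (10 / K) ^ 2 * v x ^ 4) :=
      (hf2.add hv4').const_mul _
    rw [← ofReal_integral_eq_lintegral_ofReal hi (ae_of_all _ fun x => by positivity)]
    refine ENNReal.ofReal_le_ofReal ?_
    rw [integral_const_mul, integral_add hf2 hv4', integral_const_mul]
    gcongr
    have h1 : (10 / K) ^ 2 * ∫ x, v x ^ 4 ≤ (10 / K) ^ 2 * (K * D) ^ 2 := by gcongr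
    have h2 : (10 / K) ^ 2 * (K * D) ^ 2 = (10 * D) ^ 2 := by field_simp
    nlinarith
  gcongr 16 * ?_
  have hpos : ∀ x, 0 ≤ exp (32 * π ^ 2 * u x ^ 2) - 1 - 32 * π ^ 2 * u x ^ 2 := fun x => by
    linarith [add_one_le_exp (32 * π ^ 2 * u x ^ 2)]
  rw [integral_eq_lintegral_of_nonneg_ae (ae_of_all _ fun x =>
    div_nonneg (hpos x) (by positivity)) (by
      have := hu.continuous.measurable
      exact Measurable.aestronglyMeasurable (by fun_prop))]
  refine ENNReal.toReal_le_of_le_ofReal (by positivity) ?_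
  calc _ = ∫⁻ x in ball (0 : E4) 1,
        ENNReal.ofReal (exp (32 * π ^ 2 * u x ^ 2) - 1 - 32 * π ^ 2 * u x ^ 2) *
          ENNReal.ofReal (((1 - ‖x‖ ^ 2) ^ 4)⁻¹) :=
        lintegral_congr fun x => by rw [div_eq_mul_inv, ENNReal.ofReal_mul (hpos x)]
    _ ≤ ENNReal.ofReal 20000 * ENNReal.ofReal (L * 2) := hcover.trans (mul_le_mul' le_rfl hH)
    _ = _ := by
        rw [← ENNReal.ofReal_mul (by norm_num)]
        congr 1; ring
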